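/- arXiv:2208.07596 — 4 statements merged into one kernel-verified Lean document; each statement's English description precedes it below -/
import Mathlib

section
/- Let q be a positive integer, let χ be a primitive Dirichlet character modulo q, and let k ≥ 1 and ℓ > 0 be real numbers. Assume that every zero ρ of L(s,χ) with 0 < Re(ρ) < 1 satisfies Re(ρ) = 1/2. Then for every ε > 0 there exist C > 0 and x₀ > 0 such that |P_{k,ℓ,χ}(x)| ≤ C·x^{−k/ℓ + 1/(2ℓ) + ε} for all x ≥ x₀. -/
open Complex

/-- `P χ k ℓ x = ∑_{n=1}^∞ χ(n) μ(n) n^{-k} exp(-x/n^ℓ)`. -/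
noncomputable def P {q : ℕ} (χ : DirichletCharacter ℂ q) (k ℓ x : ℝ) : ℂ :=
  ∑' n : ℕ, χ (n : ZMod q) * (ArithmeticFunction.moebius n : ℂ) *
    (((n : ℝ) ^ (-k) * Real.exp (-x / (n : ℝ) ^ ℓ) : ℝ) : ℂ)

open Metric Set Filter Topology MeasureTheory


/-- A zero-free holomorphic function on a disc is, up to its central value, the exponential of
a holomorphic function vanishing at the centre. -/
lemma exists_log_of_ne_zero_on_ball {f : ℂ → ℂ} {c : ℂ} {R : ℝ}
    (hR : 0 < R) (hf : DifferentiableOn ℂ f (ball c R)) (h0 : ∀ z ∈ ball c R, f z ≠ 0) :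
    ∃ g : ℂ → ℂ, DifferentiableOn ℂ g (ball c R) ∧ g c = 0 ∧
      ∀ z ∈ ball c R, f z = f c * exp (g z) := by
  have hd : DifferentiableOn ℂ (fun z => deriv f z / f z) (ball c R) :=
    (hf.deriv isOpen_ball).div hf h0
  obtain ⟨g, hg⟩ := hd.isExactOn_ball
  have hc : c ∈ ball c R := mem_ball_self hR
  refine ⟨fun z => g z - g c, fun z hz =>
    ((hg z hz).differentiableAt.sub_const _).differentiableWithinAt, by simp, fun z hz => ?_⟩
  have hder : ∀ w ∈ ball c R, HasDerivAt (fun w => f w * exp (-g w)) 0 w := by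
    intro w hw
    have h1 := (hf.differentiableAt (isOpen_ball.mem_nhds hw)).hasDerivAt
    have h2 := h1.mul (hg w hw).neg.cexp
    refine h2.congr_deriv ?_
    have hw0 := h0 w hw
    simp only [Pi.neg_apply]
    field_simp
    ring
  have hconst : f z * exp (-g z) = f c * exp (-g c) :=
    isOpen_ball.is_const_of_deriv_eq_zero (convex_ball c R).isPreconnected
      (fun w hw => (hder w hw).differentiableAt.differentiableWithinAt)
      (fun w hw => (hder w hw).deriv) hz hc
  calc f z = f z * exp (-g z) * exp (g z) := by rw [mul_assoc, ← exp_add]; simp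
    _ = f c * exp (g z - g c) := by rw [hconst, mul_assoc, ← exp_add]; ring_nf

/-- Lower bound for a zero-free holomorphic function on a disc in terms of its maximum. -/
lemma norm_inv_le_of_ne_zero_on_ball {f : ℂ → ℂ} {c z : ℂ} {r R A : ℝ} (hr : 0 ≤ r) (hrR : r < R)
    (hf : DifferentiableOn ℂ f (ball c R)) (h0 : ∀ w ∈ ball c R, f w ≠ 0) (hA : 1 < A)
    (hfA : ∀ w ∈ ball c R, ‖f w‖ ≤ A * ‖f c‖) (hz : ‖z - c‖ ≤ r) :
    ‖(f z)⁻¹‖ ≤ ‖(f c)⁻¹‖ * A ^ (2 * r / (R - r)) := by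
  have hR : 0 < R := hr.trans_lt hrR
  obtain ⟨g, hg, hgc, hfg⟩ := exists_log_of_ne_zero_on_ball hR hf h0
  have hmem : ∀ w ∈ ball (0 : ℂ) R, w + c ∈ ball c R := fun w hw => by
    simpa [mem_ball_iff_norm] using hw
  have hA0 : 0 < A := one_pos.trans hA
  have hM : 0 < Real.log A := Real.log_pos hA
  have hfc : 0 < ‖f c‖ := norm_pos_iff.mpr (h0 c (mem_ball_self hR))
  have hre : MapsTo (fun w => g (w + c)) (ball 0 R) {w | w.re ≤ Real.log A} := by
    intro w hw
    have h1 := hfA _ (hmem w hw)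
    rw [hfg _ (hmem w hw), norm_mul, mul_comm, norm_exp] at h1
    exact (Real.le_log_iff_exp_le hA0).mpr (le_of_mul_le_mul_right h1 hfc)
  have hz0 : z - c ∈ ball (0 : ℂ) R := by simpa [mem_ball_iff_norm] using hz.trans_lt hrR
  have hb := borelCaratheodory_zero hM
    (hg.comp (by fun_prop) hmem : DifferentiableOn ℂ (g ∘ fun w => w + c) (ball 0 R)) hre hR hz0
    (by simpa using hgc)
  simp only [Function.comp_apply, sub_add_cancel] at hb
  have hb' : ‖g z‖ ≤ Real.log A * (2 * r / (R - r)) := by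
    refine hb.trans ?_
    have : 0 < R - r := sub_pos.mpr hrR
    calc 2 * Real.log A * ‖z - c‖ / (R - ‖z - c‖) ≤ 2 * Real.log A * r / (R - r) := by gcongr
      _ = _ := by ring
  have hzc : z ∈ ball c R := by simpa using hmem _ hz0
  rw [hfg z hzc, mul_inv, norm_mul, ← exp_neg, norm_exp, Real.rpow_def_of_pos hA0]
  gcongr
  exact ((abs_re_le_norm _).trans' (neg_le_abs _)).trans hb'

/-- On a vertical strip in the right half-plane `Γ` decays faster than any power. -/
lemma exists_norm_Gamma_le (N : ℕ) : ∀ {a b : ℝ}, 0 < a → ∃ C > 0, ∀ s : ℂ, a ≤ s.re → s.re ≤ b →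
    ‖Gamma s‖ ≤ C / (1 + ‖s‖) ^ N := by
  induction N with
  | zero =>
    intro a b ha
    have hcont : ContinuousOn Real.Gamma (Icc a b) := fun x hx =>
      (Real.differentiableAt_Gamma fun m => by
        have := ha.trans_le hx.1
        have : (0 : ℝ) ≤ m := m.cast_nonneg
        linarith).continuousAt.continuousWithinAt
    obtain ⟨C, hC⟩ := isCompact_Icc.exists_bound_of_continuousOn hcont
    refine ⟨max C 1, by positivity, fun s hs1 hs2 => ?_⟩
    have hs : 0 < s.re := ha.trans_le hs1
    have h1 : ‖Gamma s‖ ≤ Real.Gamma s.re := by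
      rw [Gamma_eq_integral hs, GammaIntegral, Real.Gamma_eq_integral hs]
      refine (norm_integral_le_integral_norm _).trans_eq ?_
      refine setIntegral_congr_fun measurableSet_Ioi fun x hx => ?_
      rw [norm_mul, norm_cpow_eq_rpow_re_of_pos hx, norm_real, Real.norm_eq_abs, Real.abs_exp]
      simp
    have h2 := (le_abs_self _).trans (hC s.re ⟨hs1, hs2⟩)
    simpa using Or.inl (h1.trans h2)
  | succ N ih =>
    intro a b ha
    obtain ⟨C, hC, h⟩ := ih (a := a + 1) (b := b + 1) (by linarith)
    refine ⟨C * (1 + 1 / a), by positivity, fun s hs1 hs2 => ?_⟩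
    have hs : 0 < s.re := ha.trans_le hs1
    have hs0 : s ≠ 0 := fun h => by simp [h] at hs
    have hG : Gamma s = Gamma (s + 1) / s := by rw [Gamma_add_one s hs0]; field_simp
    have hn : a ≤ ‖s‖ := hs1.trans (re_le_norm s)
    have h1 := h (s + 1) (by simpa using hs1) (by simpa using hs2)
    have h2 : ‖s‖ ≤ ‖s + 1‖ := by
      rw [norm_def, norm_def]
      apply Real.sqrt_le_sqrt
      simp only [normSq_apply, add_re, one_re, add_im, one_im]
      nlinarith
    have h3 : 1 / ‖s‖ ≤ (1 + 1 / a) / (1 + ‖s‖) := by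
      have : 0 < ‖s‖ := ha.trans_le hn
      rw [div_le_div_iff₀ this (by positivity)]
      have : 1 ≤ ‖s‖ / a := (one_le_div ha).mpr hn
      calc 1 * (1 + ‖s‖) ≤ ‖s‖ / a + ‖s‖ := by linarith
        _ = _ := by ring
    calc ‖Gamma s‖ = ‖Gamma (s + 1)‖ * (1 / ‖s‖) := by rw [hG, norm_div]; ring
      _ ≤ C / (1 + ‖s + 1‖) ^ N * ((1 + 1 / a) / (1 + ‖s‖)) := by gcongr
      _ ≤ C / (1 + ‖s‖) ^ N * ((1 + 1 / a) / (1 + ‖s‖)) := by gcongr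
      _ = _ := by rw [pow_succ]; field_simp

lemma div_one_add_norm_sq_le {C : ℝ} (hC : 0 ≤ C) (σ y : ℝ) :
    C / (1 + ‖(σ + y * I : ℂ)‖) ^ 2 ≤ C * (1 + y ^ 2)⁻¹ := by
  have h : |y| ≤ ‖(σ + y * I : ℂ)‖ := by simpa using abs_im_le_norm (σ + y * I : ℂ)
  rw [div_eq_mul_inv]
  gcongr
  nlinarith [abs_nonneg y, sq_abs y]

/-- A function continuous on a vertical line with quadratic decay is integrable on that line. -/
lemma integrable_vertical_of_norm_le {F : ℂ → ℂ} {C σ : ℝ} (hC : 0 ≤ C)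
    (hF : Continuous fun y : ℝ => F (σ + y * I))
    (hb : ∀ y : ℝ, ‖F (σ + y * I)‖ ≤ C / (1 + ‖(σ + y * I : ℂ)‖) ^ 2) :
    Integrable fun y : ℝ => F (σ + y * I) :=
  (integrable_inv_one_add_sq.const_mul C).mono' hF.aestronglyMeasurable
    (.of_forall fun y => (hb y).trans (div_one_add_norm_sq_le hC σ y))

/-- Shifting a vertical line of integration for a function with quadratic decay. -/
lemma integral_vertical_eq_of_norm_le {F : ℂ → ℂ} {a b C : ℝ} (hC : 0 ≤ C) (hab : a ≤ b)
    (hF : ∀ s : ℂ, a ≤ s.re → s.re ≤ b → DifferentiableAt ℂ F s)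
    (hb : ∀ s : ℂ, a ≤ s.re → s.re ≤ b → ‖F s‖ ≤ C / (1 + ‖s‖) ^ 2) :
    ∫ y : ℝ, F (a + y * I) = ∫ y : ℝ, F (b + y * I) := by
  have hcont : ∀ σ : ℝ, a ≤ σ → σ ≤ b → Continuous fun y : ℝ => F (σ + y * I) := by
    intro σ h1 h2
    refine continuous_iff_continuousAt.mpr fun y => ?_
    have := (hF (σ + y * I) (by simpa using h1) (by simpa using h2)).continuousAt
    exact ContinuousAt.comp (f := fun y : ℝ => (σ + y * I : ℂ)) this (by fun_prop)
  have hint : ∀ σ : ℝ, a ≤ σ → σ ≤ b → Integrable fun y : ℝ => F (σ + y * I) :=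
    fun σ h1 h2 => integrable_vertical_of_norm_le hC (hcont σ h1 h2)
      fun y => hb _ (by simpa using h1) (by simpa using h2)
  have hlim : ∀ σ : ℝ, a ≤ σ → σ ≤ b →
      Tendsto (fun T : ℝ => ∫ y in (-T)..T, F (σ + y * I)) atTop (𝓝 (∫ y : ℝ, F (σ + y * I))) :=
    fun σ h1 h2 => intervalIntegral_tendsto_integral (hint σ h1 h2) tendsto_neg_atTop_atBot
      tendsto_id
  have hdec : Tendsto (fun T : ℝ => C * (1 + T ^ 2)⁻¹ * |b - a|) atTop (𝓝 0) := by
    have h : Tendsto (fun T : ℝ => 1 + T ^ 2) atTop atTop :=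
      tendsto_atTop_add_const_left _ _ (tendsto_pow_atTop two_ne_zero)
    simpa using (h.inv_tendsto_atTop.const_mul C).mul_const |b - a|
  have hside : ∀ y : ℝ, ‖∫ x in a..b, F (x + y * I)‖ ≤ C * (1 + y ^ 2)⁻¹ * |b - a| := by
    intro y
    refine intervalIntegral.norm_integral_le_of_norm_le_const fun x hx => ?_
    rw [uIoc_of_le hab] at hx
    exact (hb _ (by simpa using hx.1.le) (by simpa using hx.2)).trans (div_one_add_norm_sq_le hC x y)
  have hbot : Tendsto (fun T : ℝ => ∫ x in a..b, F (x + (-T : ℝ) * I)) atTop (𝓝 0) :=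
    squeeze_zero_norm (fun T => by simpa using hside (-T)) hdec
  have htop : Tendsto (fun T : ℝ => ∫ x in a..b, F (x + T * I)) atTop (𝓝 0) :=
    squeeze_zero_norm hside hdec
  have hrect : ∀ T : ℝ, (∫ x in a..b, F (x + (-T : ℝ) * I)) - (∫ x in a..b, F (x + T * I)) +
      I • (∫ y in (-T)..T, F (b + y * I)) - I • (∫ y in (-T)..T, F (a + y * I)) = 0 := by
    intro T
    have := integral_boundary_rect_eq_zero_of_differentiableOn F (a + (-T : ℝ) * I) (b + T * I)
      (fun s hs => by
        rw [mem_reProdIm] at hs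
        have h1 := hs.1
        simp [uIcc_of_le hab] at h1
        exact (hF s h1.1 h1.2).differentiableWithinAt)
    simpa using this
  have hl := ((hbot.sub htop).add ((hlim b hab le_rfl).const_smul I)).sub
    ((hlim a le_rfl hab).const_smul I)
  have h0 := tendsto_nhds_unique hl (tendsto_const_nhds.congr fun T => (hrect T).symm)
  simp only [sub_zero, zero_add, smul_eq_mul, ← mul_sub] at h0
  exact (sub_eq_zero.mp ((mul_eq_zero.mp h0).resolve_left I_ne_zero)).symm

/-- The deviation of the summatory function of `f` from the linear function `m * u`, cut off at
`u = 1`. -/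
noncomputable def sumRemainder (f : ℕ → ℂ) (m : ℂ) : ℝ → ℂ :=
  (Ioi (1 : ℝ)).indicator fun u => ∑ k ∈ Finset.Icc 1 ⌊u⌋₊, f k - m * u

section sumRemainder

variable {f : ℕ → ℂ} {m : ℂ} {B : ℝ}

lemma measurable_sumRemainder : Measurable (sumRemainder f m) := by
  have h : Measurable fun n : ℕ => ∑ k ∈ Finset.Icc 1 n, f k := measurable_from_nat
  exact ((h.comp Nat.measurable_floor).sub (by fun_prop)).indicator measurableSet_Ioi

lemma norm_sumRemainder_le (hB : ∀ n : ℕ, ‖∑ k ∈ Finset.Icc 1 n, f k - m * n‖ ≤ B) (u : ℝ) :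
    ‖sumRemainder f m u‖ ≤ B + ‖m‖ := by
  have hB0 : 0 ≤ B := (norm_nonneg _).trans (hB 0)
  by_cases hu : u ∈ Ioi (1 : ℝ)
  · rw [sumRemainder, indicator_of_mem hu]
    have hu0 : 0 ≤ u := zero_le_one.trans (le_of_lt hu)
    calc ‖∑ k ∈ Finset.Icc 1 ⌊u⌋₊, f k - m * u‖
        = ‖(∑ k ∈ Finset.Icc 1 ⌊u⌋₊, f k - m * ⌊u⌋₊) + m * ((⌊u⌋₊ - u : ℝ) : ℂ)‖ := by
          push_cast; ring_nf
      _ ≤ B + ‖m‖ * 1 := by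
          refine (norm_add_le _ _).trans (add_le_add (hB _) ?_)
          rw [norm_mul, norm_real, Real.norm_eq_abs]
          gcongr
          rw [abs_le]
          constructor <;> linarith [Nat.floor_le hu0, Nat.lt_floor_add_one u]
      _ = _ := by rw [mul_one]
  · rw [sumRemainder, indicator_of_notMem hu, norm_zero]
    positivity

lemma differentiableAt_mellin_sumRemainder
    (hB : ∀ n : ℕ, ‖∑ k ∈ Finset.Icc 1 n, f k - m * n‖ ≤ B) {s : ℂ} (hs : 0 < s.re) :
    DifferentiableAt ℂ (fun s => mellin (sumRemainder f m) (-s)) s := by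
  have hloc : LocallyIntegrable (sumRemainder f m) :=
    (locallyIntegrable_const (B + ‖m‖)).mono measurable_sumRemainder.aestronglyMeasurable
      (.of_forall fun u => (norm_sumRemainder_le hB u).trans (le_abs_self _))
  have htop : sumRemainder f m =O[atTop] fun u : ℝ => u ^ (-(0 : ℝ)) := by
    refine Asymptotics.IsBigO.of_bound (B + ‖m‖) (.of_forall fun u => ?_)
    simpa using norm_sumRemainder_le hB u
  have hbot : sumRemainder f m =O[𝓝[>] 0] fun u : ℝ => u ^ (-(-s.re - 1)) := by
    refine Asymptotics.IsBigO.of_bound 1 ?_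
    filter_upwards [nhdsWithin_le_nhds (Iio_mem_nhds one_pos)] with u hu
    rw [sumRemainder, indicator_of_notMem (notMem_Ioi.mpr (le_of_lt (mem_Iio.mp hu)))]
    simp
  have := mellin_differentiableAt_of_isBigO_rpow (hloc.locallyIntegrableOn _) htop
    (s := -s) (by simpa using hs) hbot (by simp)
  exact DifferentiableAt.comp (f := fun s : ℂ => -s) s this (by fun_prop)

lemma mellin_sumRemainder_eq (s : ℂ) : mellin (sumRemainder f m) (-s) =
    ∫ u in Ioi (1 : ℝ), (u : ℂ) ^ (-s - 1) * sumRemainder f m u := by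
  simp only [mellin, smul_eq_mul]
  refine setIntegral_eq_of_subset_of_forall_sdiff_eq_zero measurableSet_Ioi
    (Ioi_subset_Ioi zero_le_one) fun u hu => ?_
  rw [sumRemainder, indicator_of_notMem hu.2, mul_zero]

lemma norm_mellin_sumRemainder_le
    (hB : ∀ n : ℕ, ‖∑ k ∈ Finset.Icc 1 n, f k - m * n‖ ≤ B) {s : ℂ} (hs : 0 < s.re) :
    ‖mellin (sumRemainder f m) (-s)‖ ≤ (B + ‖m‖) / s.re := by
  rw [mellin_sumRemainder_eq]
  have hint := integrableOn_Ioi_rpow_of_lt (a := -s.re - 1) (by linarith) one_pos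
  calc ‖∫ u in Ioi (1 : ℝ), (u : ℂ) ^ (-s - 1) * sumRemainder f m u‖
      ≤ ∫ u in Ioi (1 : ℝ), u ^ (-s.re - 1) * (B + ‖m‖) := by
        refine norm_integral_le_of_norm_le (hint.mul_const _) ?_
        refine (ae_restrict_iff' measurableSet_Ioi).mpr (.of_forall fun u hu => ?_)
        have hu0 : 0 < u := one_pos.trans hu
        rw [norm_mul, norm_cpow_eq_rpow_re_of_pos hu0]
        simp only [sub_re, neg_re, one_re]
        gcongr
        exact norm_sumRemainder_le hB u
    _ = (B + ‖m‖) / s.re := by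
        rw [integral_mul_const, integral_Ioi_rpow_of_lt (by linarith) one_pos]
        simp
        field_simp

/-- Abel summation: the L-series of `f` in terms of the Mellin transform of the remainder. -/
lemma LSeries_eq_mellin_sumRemainder
    (hB : ∀ n : ℕ, ‖∑ k ∈ Finset.Icc 1 n, f k - m * n‖ ≤ B) {s : ℂ} (hs : 1 < s.re)
    (hS : LSeriesSummable f s) :
    LSeries f s = m * s / (s - 1) + s * mellin (sumRemainder f m) (-s) := by
  have hO : (fun n : ℕ => ∑ k ∈ Finset.Icc 1 n, f k) =O[atTop] fun n : ℕ => (n : ℝ) ^ (1 : ℝ) := by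
    refine Asymptotics.IsBigO.of_bound (B + ‖m‖) ?_
    filter_upwards [eventually_ge_atTop 1] with n hn
    have hn' : (1 : ℝ) ≤ n := by exact_mod_cast hn
    have hB0 : 0 ≤ B := (norm_nonneg _).trans (hB 0)
    calc ‖∑ k ∈ Finset.Icc 1 n, f k‖
        = ‖(∑ k ∈ Finset.Icc 1 n, f k - m * n) + m * n‖ := by ring_nf
      _ ≤ B + ‖m‖ * n := (norm_add_le _ _).trans (add_le_add (hB n) (by simp))
      _ ≤ (B + ‖m‖) * n := by nlinarith
      _ = _ := by simp
  rw [LSeries_eq_mul_integral f zero_le_one hs hS hO]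
  have hs1 : s - 1 ≠ 0 := sub_ne_zero.mpr fun h => by simp [h] at hs
  have hint1 : IntegrableOn (fun u : ℝ => (u : ℂ) ^ (-s - 1) * sumRemainder f m u) (Ioi 1) := by
    have hint := integrableOn_Ioi_cpow_of_lt (a := -s - 1) (by simp; linarith) one_pos
    exact hint.mul_bdd measurable_sumRemainder.aestronglyMeasurable
      (.of_forall (norm_sumRemainder_le hB))
  have hint2 : IntegrableOn (fun u : ℝ => m * (u : ℂ) ^ (-s)) (Ioi 1) :=
    (integrableOn_Ioi_cpow_of_lt (by simpa using hs) one_pos).const_mul m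
  have hsplit : ∫ t in Ioi (1 : ℝ), (∑ k ∈ Finset.Icc 1 ⌊t⌋₊, f k) * (t : ℂ) ^ (-(s + 1)) =
      m / (s - 1) + mellin (sumRemainder f m) (-s) := by
    have hm : ∫ u in Ioi (1 : ℝ), m * (u : ℂ) ^ (-s) = m / (s - 1) := by
      rw [integral_const_mul, integral_Ioi_cpow_of_lt (by simpa using hs) one_pos]
      have : -s + 1 ≠ 0 := fun h => hs1 (by linear_combination -h)
      simp
      field_simp
      ring
    rw [mellin_sumRemainder_eq, ← hm, ← integral_add hint2 hint1]
    refine setIntegral_congr_fun measurableSet_Ioi fun u hu => ?_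
    have hu0 : (u : ℂ) ≠ 0 := ofReal_ne_zero.mpr (one_pos.trans hu).ne'
    have hp : (u : ℂ) ^ (-s) = u * (u : ℂ) ^ (-(s + 1)) := by
      rw [neg_add, ← sub_eq_add_neg, cpow_sub _ _ hu0, cpow_one]
      field_simp
    simp only [sumRemainder, indicator_of_mem hu, hp]
    rw [show -s - 1 = -(s + 1) by ring]
    ring
  rw [hsplit]
  ring

end sumRemainder

/-- Two holomorphic functions on `0 < re s` agreeing on `1 < re s` are equal. -/
lemma eqOn_re_pos_of_eqOn_one_lt_re {F G : ℂ → ℂ}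
    (hF : ∀ s : ℂ, 0 < s.re → DifferentiableAt ℂ F s)
    (hG : ∀ s : ℂ, 0 < s.re → DifferentiableAt ℂ G s)
    (h : ∀ s : ℂ, 1 < s.re → F s = G s) {s : ℂ} (hs : 0 < s.re) : F s = G s := by
  have hU : IsOpen {s : ℂ | 0 < s.re} := isOpen_lt continuous_const continuous_re
  have hV : IsOpen {s : ℂ | 1 < s.re} := isOpen_lt continuous_const continuous_re
  have hF' : DifferentiableOn ℂ F {s : ℂ | 0 < s.re} := fun s hs => (hF s hs).differentiableWithinAt
  have hG' : DifferentiableOn ℂ G {s : ℂ | 0 < s.re} := fun s hs => (hG s hs).differentiableWithinAt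
  exact (hF'.analyticOnNhd hU).eqOn_of_preconnected_of_eventuallyEq (hG'.analyticOnNhd hU)
    (convex_halfSpace_re_gt 0).isPreconnected (z₀ := 2) (by simp)
    (by filter_upwards [hV.mem_nhds (show (2 : ℂ) ∈ _ by simp)] with z hz using h z hz) hs

/-- The partial sums of a nontrivial Dirichlet character modulo `q` are bounded by `q`. -/
lemma norm_sum_Icc_dirichletCharacter_le {q : ℕ} [NeZero q] {χ : DirichletCharacter ℂ q}
    (hχ : χ ≠ 1) (n : ℕ) : ‖∑ k ∈ Finset.Icc 1 n, χ (k : ZMod q)‖ ≤ q := by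
  set T : ℕ → ℂ := fun n => ∑ i ∈ Finset.range n, χ ((i : ZMod q) + 1) with hT
  have hTn : ∑ k ∈ Finset.Icc 1 n, χ (k : ZMod q) = T n := by
    simp only [hT]
    induction n with
    | zero => simp
    | succ n ih => rw [Finset.sum_Icc_succ_top (by omega), ih, Finset.sum_range_succ, Nat.cast_succ]
  have hTq : T q = 0 := by
    calc T q = ∑ a : ZMod q, χ (a + 1) :=
          Finset.sum_nbij' (fun i => (i : ZMod q)) ZMod.val (by simp)
            (by simp [ZMod.val_lt]) (fun i hi => ZMod.val_cast_of_lt (Finset.mem_range.mp hi))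
            (by simp) (by simp)
      _ = ∑ a : ZMod q, χ a := Equiv.sum_comp (Equiv.addRight (1 : ZMod q)) fun a => χ a
      _ = 0 := χ.sum_eq_zero_of_ne_one hχ
  have hper : Function.Periodic T q := fun n => by
    have : T (q + n) = T q + T n := by simp [hT, Finset.sum_range_add]
    rw [add_comm, this, hTq, zero_add]
  rw [hTn, ← hper.map_mod_nat n]
  calc ‖T (n % q)‖ ≤ ∑ i ∈ Finset.range (n % q), (1 : ℝ) :=
        norm_sum_le_of_le _ fun i _ => χ.norm_le_one _
    _ = (n % q : ℕ) := by simp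
    _ ≤ q := by exact_mod_cast (Nat.mod_lt n (NeZero.pos q)).le

/-- After removing the possible pole at `1`, an L-function satisfying GRH is holomorphic and
zero-free on `1/2 < re s`, where it grows at most quadratically. -/
lemma exists_regularized_LFunction {q : ℕ} [NeZero q] {χ : DirichletCharacter ℂ q}
    (hχ : χ.IsPrimitive)
    (hGRH : ∀ ρ : ℂ, DirichletCharacter.LFunction χ ρ = 0 → 0 < ρ.re → ρ.re < 1 →
      ρ.re = 1 / 2) :
    ∃ (K : ℂ → ℂ) (e : ℕ) (C : ℝ), 0 < C ∧
      (∀ s : ℂ, 1 / 2 < s.re → DifferentiableAt ℂ K s) ∧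
      (∀ s : ℂ, 1 / 2 < s.re → K s ≠ 0) ∧
      (∀ s : ℂ, 1 / 2 < s.re → ‖K s‖ ≤ C * (1 + ‖s‖) ^ 2) ∧
      ∀ s : ℂ, 1 < s.re → K s = (s - 1) ^ e * LSeries (fun n => χ n) s := by
  have hne : ∀ s : ℂ, 1 / 2 < s.re → (χ ≠ 1 ∨ s ≠ 1) → DirichletCharacter.LFunction χ s ≠ 0 := by
    intro s hs h h0
    rcases lt_or_ge s.re 1 with h1 | h1
    · linarith [hGRH s h0 (by linarith) h1]
    · exact χ.LFunction_ne_zero_of_one_le_re h h1 h0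
  have hinv : ∀ s : ℂ, 1 / 2 < s.re → ∀ {B : ℝ}, 0 ≤ B → B / s.re ≤ 2 * B := by
    intro s hs B hB
    rw [div_le_iff₀ (by linarith)]
    nlinarith
  by_cases h1 : χ = 1
  · have hq : q = 1 := by
      rw [DirichletCharacter.isPrimitive_def, h1, DirichletCharacter.conductor_one] at hχ
      exact hχ.symm
    subst hq h1
    have hone : ∀ n : ℕ, (1 : DirichletCharacter ℂ 1) (n : ZMod 1) = 1 := fun n =>
      MulChar.one_apply (isUnit_of_subsingleton _)
    have hB : ∀ n : ℕ, ‖∑ k ∈ Finset.Icc 1 n, (1 : DirichletCharacter ℂ 1) (k : ZMod 1) - 1 * n‖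
        ≤ 0 := fun n => by simp [hone]
    set J : ℂ → ℂ := fun s =>
      mellin (sumRemainder (fun n => (1 : DirichletCharacter ℂ 1) (n : ZMod 1)) 1) (-s) with hJ
    have hrep : ∀ s : ℂ, 0 < s.re →
        DirichletCharacter.LFunctionTrivChar₁ 1 s = s + (s - 1) * (s * J s) := by
      intro s hs
      refine eqOn_re_pos_of_eqOn_one_lt_re (G := fun s => s + (s - 1) * (s * J s))
        (fun s _ => DirichletCharacter.differentiable_LFunctionTrivChar₁ 1 s)
        (fun s hs => ?_) (fun s hs => ?_) hs
      · have := differentiableAt_mellin_sumRemainder hB hs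
        fun_prop
      · have hs1 : s ≠ 1 := fun h => by simp [h] at hs
        have hs1' : s - 1 ≠ 0 := sub_ne_zero.mpr hs1
        rw [DirichletCharacter.LFunctionTrivChar₁, Function.update_of_ne hs1,
          DirichletCharacter.LFunctionTrivChar, DirichletCharacter.LFunction_eq_LSeries _ hs,
          LSeries_eq_mellin_sumRemainder hB hs
            (DirichletCharacter.LSeriesSummable_of_one_lt_re _ hs)]
        simp only [hJ]
        field_simp
    refine ⟨DirichletCharacter.LFunctionTrivChar₁ 1, 1, 3, by norm_num,
      fun s _ => DirichletCharacter.differentiable_LFunctionTrivChar₁ 1 s,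
      fun s hs => ?_, fun s hs => ?_, fun s hs => ?_⟩
    · by_cases hs1 : s = 1
      · rw [hs1]
        exact DirichletCharacter.LFunctionTrivChar₁_apply_one_ne_zero 1
      · rw [DirichletCharacter.LFunctionTrivChar₁, Function.update_of_ne hs1]
        exact mul_ne_zero (sub_ne_zero.mpr hs1) (hne s hs (.inr hs1))
    · have hJb : ‖J s‖ ≤ 2 := by
        have := norm_mellin_sumRemainder_le hB (s := s) (by linarith)
        have h2 := hinv s hs zero_le_one
        simp only [norm_one, zero_add] at this
        linarith
      rw [hrep s (by linarith)]
      calc ‖s + (s - 1) * (s * J s)‖ ≤ ‖s‖ + ‖s - 1‖ * (‖s‖ * ‖J s‖) := by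
            simpa only [norm_mul] using norm_add_le s ((s - 1) * (s * J s))
        _ ≤ ‖s‖ + (‖s‖ + 1) * (‖s‖ * 2) := by
            gcongr
            simpa using norm_sub_le s 1
        _ ≤ _ := by nlinarith [norm_nonneg s]
    · have hs1 : s ≠ 1 := fun h => by simp [h] at hs
      rw [DirichletCharacter.LFunctionTrivChar₁, Function.update_of_ne hs1,
        DirichletCharacter.LFunctionTrivChar, DirichletCharacter.LFunction_eq_LSeries _ hs, pow_one]
  · have hB : ∀ n : ℕ, ‖∑ k ∈ Finset.Icc 1 n, χ (k : ZMod q) - 0 * n‖ ≤ q := fun n => by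
      simpa using norm_sum_Icc_dirichletCharacter_le h1 n
    have hrep : ∀ s : ℂ, 0 < s.re → DirichletCharacter.LFunction χ s =
        s * mellin (sumRemainder (fun n => χ (n : ZMod q)) 0) (-s) := by
      intro s hs
      refine eqOn_re_pos_of_eqOn_one_lt_re
        (fun s _ => DirichletCharacter.differentiable_LFunction h1 s)
        (fun s hs => differentiableAt_id.mul (differentiableAt_mellin_sumRemainder hB hs))
        (fun s hs => ?_) hs
      rw [DirichletCharacter.LFunction_eq_LSeries _ hs, LSeries_eq_mellin_sumRemainder hB hs
        (DirichletCharacter.LSeriesSummable_of_one_lt_re _ hs)]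
      simp
    have hqpos : (0 : ℝ) < q := by exact_mod_cast NeZero.pos q
    refine ⟨DirichletCharacter.LFunction χ, 0, 2 * q, by positivity,
      fun s _ => DirichletCharacter.differentiable_LFunction h1 s,
      fun s hs => hne s hs (.inl h1), fun s hs => ?_, fun s hs => ?_⟩
    · have hJb := (norm_mellin_sumRemainder_le hB (s := s) (by linarith)).trans
        (hinv s hs (by positivity))
      rw [hrep s (by linarith), norm_mul]
      calc _ ≤ ‖s‖ * (2 * (q + ‖(0 : ℂ)‖)) := by gcongr
        _ = 2 * q * ‖s‖ := by rw [norm_zero]; ring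
        _ ≤ _ := by
          gcongr
          nlinarith [norm_nonneg s]
    · rw [DirichletCharacter.LFunction_eq_LSeries _ hs, pow_zero, one_mul]

open ArithmeticFunction in
/-- Under GRH the Dirichlet series of `χ * μ` continues holomorphically to `1/2 < re s`, with
polynomial growth on each vertical strip of positive distance from the critical line. -/
lemma exists_continuation_LSeries_mul_moebius {q : ℕ} [NeZero q] {χ : DirichletCharacter ℂ q}
    (hχ : χ.IsPrimitive)
    (hGRH : ∀ ρ : ℂ, DirichletCharacter.LFunction χ ρ = 0 → 0 < ρ.re → ρ.re < 1 →
      ρ.re = 1 / 2) :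
    ∃ W : ℂ → ℂ, (∀ s : ℂ, 1 / 2 < s.re → DifferentiableAt ℂ W s) ∧
      (∀ s : ℂ, 1 < s.re → W s = LSeries (fun n : ℕ => χ n * (moebius n : ℂ)) s) ∧
      ∀ δ > 0, ∀ B : ℝ, ∃ C > 0, ∃ N : ℕ, ∀ s : ℂ, 1 / 2 + δ ≤ s.re → s.re ≤ B →
        ‖W s‖ ≤ C * (1 + ‖s‖) ^ N := by
  obtain ⟨K, e, C, hC, hdiff, hne, hbound, hK⟩ := exists_regularized_LFunction hχ hGRH
  set a : ℕ → ℂ := fun n => χ n * (moebius n : ℂ)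
  have hsum : ∀ s : ℂ, 1 < s.re → LSeriesSummable a s := fun s hs =>
    χ.LSeriesSummable_mul (LSeriesSummable_moebius_iff.mpr hs)
  have hW : ∀ s : ℂ, 1 < s.re → (s - 1) ^ e * (K s)⁻¹ = LSeries a s := by
    intro s hs
    have hs1 : s - 1 ≠ 0 := sub_ne_zero.mpr fun h => by simp [h] at hs
    have h1 := DirichletCharacter.LSeries.mul_mu_eq_one χ hs
    have h2 : LSeries (fun n => χ n) s ≠ 0 := left_ne_zero_of_mul_eq_one h1
    rw [hK s hs, mul_inv, ← mul_assoc, mul_inv_cancel₀ (pow_ne_zero _ hs1), one_mul]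
    exact inv_eq_of_mul_eq_one_right h1
  refine ⟨fun s => (s - 1) ^ e * (K s)⁻¹, fun s hs => ?_, hW, fun δ hδ B₀ => ?_⟩
  · exact DifferentiableAt.mul (by fun_prop) ((hdiff s hs).inv (hne s hs))
  obtain ⟨B, hB0, hB2⟩ : ∃ B, B₀ ≤ B ∧ 2 ≤ B := ⟨max B₀ 2, le_max_left _ _, le_max_right _ _⟩
  set c₀ : ℝ := ∑' n, ‖LSeries.term a 2 n‖
  have hc₀ : 0 ≤ c₀ := tsum_nonneg fun _ => norm_nonneg _
  have hinv : ∀ s : ℂ, 2 ≤ s.re → ‖(K s)⁻¹‖ ≤ c₀ := by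
    intro s hs
    have h1 : ‖LSeries a s‖ ≤ c₀ := by
      have h2 := (hsum 2 (by simp)).norm
      have hle : ∀ n, ‖LSeries.term a s n‖ ≤ ‖LSeries.term a 2 n‖ := fun n =>
        LSeries.norm_term_le_of_re_le_re a (by simpa using hs) n
      exact (norm_tsum_le_tsum_norm (h2.of_nonneg_of_le (fun _ => norm_nonneg _) hle)).trans
        ((h2.of_nonneg_of_le (fun _ => norm_nonneg _) hle).tsum_le_tsum hle h2)
    rw [← hW s (by linarith), norm_mul, norm_pow] at h1
    have h2 : 1 ≤ ‖s - 1‖ := by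
      have := re_le_norm (s - 1)
      simp at this
      linarith
    exact (le_mul_of_one_le_left (norm_nonneg _) (one_le_pow₀ h2)).trans h1
  set R : ℝ := B - 1 / 2
  set p : ℝ := 2 * (R - δ) / (R - (R - δ)) with hp
  set A₀ : ℝ := 2 + c₀ * C * (1 + 2 * R) ^ 2 with hA₀
  have hA₀2 : 2 ≤ A₀ := by
    rw [hA₀]
    exact le_add_of_nonneg_right (by positivity)
  refine ⟨(c₀ + 1) * A₀ ^ p, by positivity, e + ⌈2 * p⌉₊, fun z hz1 hz2 => ?_⟩
  set c : ℂ := B + z.im * I with hc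
  have hcre : c.re = B := by simp [hc]
  have hzc : ‖z - c‖ ≤ R - δ := by
    have : z - c = ((z.re - B : ℝ) : ℂ) := by
      apply Complex.ext <;> simp [hc]
    rw [this, norm_real, Real.norm_eq_abs, abs_of_nonpos (by linarith)]
    simp only [R]
    linarith
  have hball : ∀ w ∈ ball c R, 1 / 2 < w.re := by
    intro w hw
    have h1 := (abs_re_le_norm (w - c)).trans_lt (mem_ball_iff_norm.mp hw)
    rw [sub_re, hcre, abs_lt] at h1
    simp only [R] at h1
    linarith [h1.1]
  have hR : 0 < R := by simp only [R]; linarith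
  have hKc : ‖K c‖ ≠ 0 := norm_ne_zero_iff.mpr (hne c (by rw [hcre]; linarith))
  have hz1' : 1 ≤ 1 + ‖z‖ := by linarith [norm_nonneg z]
  have hcinv := hinv c (by rw [hcre]; exact hB2)
  have hA : ∀ w ∈ ball c R, ‖K w‖ ≤ (A₀ * (1 + ‖z‖) ^ 2) * ‖K c‖ := by
    intro w hw
    have h1 : ‖w‖ ≤ ‖z‖ + 2 * R := by
      have h2 : w = z - (z - c) + (w - c) := by ring
      have h3 := mem_ball_iff_norm.mp hw
      calc ‖w‖ = ‖z - (z - c) + (w - c)‖ := by rw [← h2]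
        _ ≤ ‖z‖ + ‖z - c‖ + ‖w - c‖ := (norm_add_le _ _).trans (by gcongr; exact norm_sub_le _ _)
        _ ≤ _ := by linarith
    have h2 : 1 + ‖w‖ ≤ (1 + 2 * R) * (1 + ‖z‖) := by nlinarith [norm_nonneg z]
    have h3 : 1 ≤ c₀ * ‖K c‖ := by
      rw [norm_inv] at hcinv
      have := mul_le_mul_of_nonneg_right hcinv (norm_nonneg (K c))
      rwa [inv_mul_cancel₀ hKc] at this
    calc ‖K w‖ ≤ C * (1 + ‖w‖) ^ 2 := hbound w (hball w hw)
      _ ≤ C * ((1 + 2 * R) * (1 + ‖z‖)) ^ 2 := by gcongr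
      _ ≤ C * ((1 + 2 * R) * (1 + ‖z‖)) ^ 2 * (c₀ * ‖K c‖) :=
          le_mul_of_one_le_right (by positivity) h3
      _ = (c₀ * C * (1 + 2 * R) ^ 2) * (1 + ‖z‖) ^ 2 * ‖K c‖ := by ring
      _ ≤ _ := by
          gcongr
          rw [hA₀]
          linarith
  have hAone : 1 < A₀ * (1 + ‖z‖) ^ 2 := by nlinarith [one_le_pow₀ (n := 2) hz1']
  have key := norm_inv_le_of_ne_zero_on_ball ((norm_nonneg _).trans hzc) (by linarith)
    (fun w hw => (hdiff w (hball w hw)).differentiableWithinAt) (fun w hw => hne w (hball w hw))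
    hAone hA hzc
  have hpow : (A₀ * (1 + ‖z‖) ^ 2) ^ p ≤ A₀ ^ p * (1 + ‖z‖) ^ ⌈2 * p⌉₊ := by
    rw [Real.mul_rpow (by positivity) (by positivity), ← Real.rpow_natCast, ← Real.rpow_mul
      (by positivity), ← Real.rpow_natCast (1 + ‖z‖) ⌈2 * p⌉₊]
    gcongr
    exact_mod_cast Nat.le_ceil (2 * p)
  calc ‖(z - 1) ^ e * (K z)⁻¹‖ = ‖z - 1‖ ^ e * ‖(K z)⁻¹‖ := by rw [norm_mul, norm_pow]
    _ ≤ (1 + ‖z‖) ^ e * (c₀ * (A₀ ^ p * (1 + ‖z‖) ^ ⌈2 * p⌉₊)) := by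
        gcongr
        · simpa [add_comm] using norm_sub_le z 1
        · exact key.trans (by gcongr)
    _ = c₀ * A₀ ^ p * (1 + ‖z‖) ^ (e + ⌈2 * p⌉₊) := by rw [pow_add]; ring
    _ ≤ _ := by
        gcongr
        linarith

lemma integrable_Gamma_vertical {c : ℝ} (hc : 0 < c) :
    Integrable fun y : ℝ => Gamma (c + y * I) := by
  obtain ⟨C, hC, h⟩ := exists_norm_Gamma_le 2 (b := c) hc
  refine integrable_vertical_of_norm_le hC.le (continuous_iff_continuousAt.mpr fun y => ?_)
    fun y => h _ (by simp) (by simp)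
  have hd : DifferentiableAt ℂ Gamma (c + y * I) := differentiableAt_Gamma _ fun m hm => by
    have h1 := congrArg re hm
    simp at h1
    have : (0 : ℝ) ≤ m := m.cast_nonneg
    linarith
  exact ContinuousAt.comp (f := fun y : ℝ => (c + y * I : ℂ)) hd.continuousAt (by fun_prop)

/-- Cahen–Mellin inversion formula for the exponential. -/
lemma exp_neg_eq_integral_Gamma {c x : ℝ} (hc : 0 < c) (hx : 0 < x) :
    ((Real.exp (-x) : ℝ) : ℂ) =
      (1 / (2 * Real.pi)) • ∫ y : ℝ, (x : ℂ) ^ (-(c + y * I : ℂ)) * Gamma (c + y * I) := by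
  have hmellin : ∀ s : ℂ, 0 < s.re → mellin (fun x : ℝ => ((Real.exp (-x) : ℝ) : ℂ)) s = Gamma s :=
    fun s hs => by rw [Gamma_eq_integral hs, GammaIntegral_eq_mellin]
  have hconv : MellinConvergent (fun x : ℝ => ((Real.exp (-x) : ℝ) : ℂ)) c := by
    refine (GammaIntegral_convergent (s := c) (by simpa using hc)).congr_fun (fun x _ => ?_)
      measurableSet_Ioi
    simp [mul_comm]
  have hvert : VerticalIntegrable (mellin fun x : ℝ => ((Real.exp (-x) : ℝ) : ℂ)) c := by
    refine (integrable_Gamma_vertical hc).congr (.of_forall fun y => ?_)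
    exact (hmellin _ (by simpa using hc)).symm
  rw [← mellinInv_mellin_eq c _ hx hconv hvert (by fun_prop), mellinInv]
  congr 2
  ext y
  rw [hmellin _ (by simpa using hc), smul_eq_mul]

open ArithmeticFunction in
/-- Mellin–Barnes representation of `P`. -/
lemma P_eq_integral {q : ℕ} (χ : DirichletCharacter ℂ q) {k ℓ x c : ℝ} (hc : 0 < c)
    (hkc : 1 < k - ℓ * c) (hx : 0 < x) :
    P χ k ℓ x = (1 / (2 * Real.pi)) • ∫ y : ℝ, (x : ℂ) ^ (-(c + y * I : ℂ)) *
      (Gamma (c + y * I) *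
        LSeries (fun n : ℕ => χ n * (moebius n : ℂ)) (k - ℓ * (c + y * I))) := by
  set a : ℕ → ℂ := fun n => χ n * (moebius n : ℂ) with ha
  have hre : ∀ y : ℝ, (k - ℓ * (c + y * I) : ℂ).re = k - ℓ * c := fun y => by simp
  have hre' : ((k - ℓ * c : ℝ) : ℂ).re = k - ℓ * c := ofReal_re _
  set F : ℕ → ℝ → ℂ := fun n y => LSeries.term a (k - ℓ * (c + y * I)) n *
    ((x : ℂ) ^ (-(c + y * I : ℂ)) * Gamma (c + y * I)) with hF
  have hFn : ∀ n : ℕ, n ≠ 0 → ∀ y : ℝ, F n y = a n * (((n : ℝ) ^ (-k) : ℝ) : ℂ) *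
      (((x / (n : ℝ) ^ ℓ : ℝ) : ℂ) ^ (-(c + y * I : ℂ)) * Gamma (c + y * I)) := by
    intro n hn y
    have hn0 : (0 : ℝ) < n := by exact_mod_cast Nat.pos_of_ne_zero hn
    have hnC : (n : ℂ) ≠ 0 := by exact_mod_cast hn
    have h1 : ((x / (n : ℝ) ^ ℓ : ℝ) : ℂ) ^ (-(c + y * I : ℂ)) =
        (x : ℂ) ^ (-(c + y * I : ℂ)) * (n : ℂ) ^ (ℓ * (c + y * I : ℂ)) := by
      rw [div_eq_mul_inv, ← Real.rpow_neg hn0.le, ofReal_mul,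
        mul_cpow_ofReal_nonneg hx.le (by positivity)]
      have hne : (((n : ℝ) ^ (-ℓ) : ℝ) : ℂ) ≠ 0 :=
        ofReal_ne_zero.mpr (Real.rpow_pos_of_pos hn0 _).ne'
      rw [cpow_def_of_ne_zero hne, cpow_def_of_ne_zero hnC, ← ofReal_log (by positivity),
        Real.log_rpow hn0, ← natCast_log]
      push_cast
      ring_nf
    have h2 : (n : ℂ) ^ (k - ℓ * (c + y * I) : ℂ) =
        (n : ℂ) ^ (k : ℂ) / (n : ℂ) ^ (ℓ * (c + y * I : ℂ)) := cpow_sub _ _ hnC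
    have h3 : (((n : ℝ) ^ (-k) : ℝ) : ℂ) = ((n : ℂ) ^ (k : ℂ))⁻¹ := by
      rw [ofReal_cpow hn0.le, ofReal_neg, cpow_neg, ofReal_natCast]
    simp only [hF]
    rw [LSeries.term_of_ne_zero hn, h1, h2, h3]
    field_simp
  have hG := integrable_Gamma_vertical hc
  have hcpow : Continuous fun y : ℝ => (x : ℂ) ^ (-(c + y * I : ℂ)) :=
    Continuous.const_cpow (by fun_prop) (.inl (ofReal_ne_zero.mpr hx.ne'))
  have hcpown : ∀ y : ℝ, ‖(x : ℂ) ^ (-(c + y * I : ℂ))‖ = x ^ (-c) := fun y => by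
    rw [norm_cpow_eq_rpow_re_of_pos hx]
    simp
  have hterm : ∀ n (y : ℝ), ‖LSeries.term a (k - ℓ * (c + y * I)) n‖ =
      ‖LSeries.term a ((k - ℓ * c : ℝ) : ℂ) n‖ := fun n y => by
    simp only [LSeries.norm_term_eq, hre, hre']
  have hFnorm : ∀ n y, ‖F n y‖ =
      ‖LSeries.term a ((k - ℓ * c : ℝ) : ℂ) n‖ * x ^ (-c) * ‖Gamma (c + y * I)‖ := fun n y => by
    simp only [hF, norm_mul, hterm, hcpown, mul_assoc]
  have htermc : ∀ n, Continuous fun y : ℝ => LSeries.term a (k - ℓ * (c + y * I)) n := by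
    intro n
    rcases eq_or_ne n 0 with rfl | hn
    · simpa using continuous_const
    · have hnC : (n : ℂ) ≠ 0 := by exact_mod_cast hn
      simp only [LSeries.term_of_ne_zero hn]
      refine continuous_const.div (Continuous.const_cpow (by fun_prop) (.inl hnC)) fun y => ?_
      simp [cpow_eq_zero_iff, hnC]
  have hFint : ∀ n, Integrable (F n) := by
    intro n
    refine (hG.norm.const_mul (‖LSeries.term a ((k - ℓ * c : ℝ) : ℂ) n‖ * x ^ (-c))).mono'
      ((htermc n).aestronglyMeasurable.mul (hcpow.aestronglyMeasurable.mul
        hG.aestronglyMeasurable)) (.of_forall fun y => (hFnorm n y).le)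
  have hSum : LSeriesSummable a ((k - ℓ * c : ℝ) : ℂ) :=
    χ.LSeriesSummable_mul (LSeriesSummable_moebius_iff.mpr (by rwa [hre']))
  have hFsum : Summable fun n => ∫ y, ‖F n y‖ := by
    simp only [hFnorm, integral_const_mul]
    exact (hSum.norm.mul_right _).mul_right _
  have key := (hasSum_integral_of_summable_integral_norm hFint hFsum).tsum_eq
  have hlhs : P χ k ℓ x = (1 / (2 * Real.pi)) • ∑' n, ∫ y, F n y := by
    rw [P, ← tsum_const_smul'']
    refine tsum_congr fun n => ?_
    rcases eq_or_ne n 0 with rfl | hn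
    · simp [hF]
    · have hn0 : (0 : ℝ) < n := by exact_mod_cast Nat.pos_of_ne_zero hn
      simp only [hFn n hn]
      rw [integral_const_mul, ← mul_smul_comm, ← exp_neg_eq_integral_Gamma hc (by positivity),
        ofReal_mul, neg_div, ← mul_assoc]
  rw [hlhs, key]
  congr 2
  ext y
  simp only [hF]
  rw [tsum_mul_right, LSeries]
  ring

/-- For `k = 1` the series defining `P` does not converge absolutely, so that `P` takes its
default value. -/
lemma P_one_eq_zero {q : ℕ} [NeZero q] (χ : DirichletCharacter ℂ q) {ℓ x : ℝ} (hℓ : 0 < ℓ)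
    (hx : 0 ≤ x) : P χ 1 ℓ x = 0 := by
  refine tsum_eq_zero_of_not_summable fun hsum => not_summable_one_div_on_primes ?_
  refine Summable.of_norm_bounded_eventually_nat (hsum.norm.mul_left (Real.exp x)) ?_
  filter_upwards [eventually_gt_atTop q] with n hn
  by_cases hp : n.Prime
  · have hn1 : (1 : ℝ) ≤ n := by exact_mod_cast hp.one_lt.le
    have hcop : n.Coprime q := (Nat.Prime.coprime_iff_not_dvd hp).mpr fun h =>
      absurd (Nat.le_of_dvd (NeZero.pos q) h) (not_le.mpr hn)
    have hχ : ‖χ (n : ZMod q)‖ = 1 := χ.unit_norm_eq_one (ZMod.unitOfCoprime n hcop)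
    have hxn : x / (n : ℝ) ^ ℓ ≤ x := div_le_self hx (Real.one_le_rpow hn1 hℓ.le)
    have hexp : 1 ≤ Real.exp x * Real.exp (-x / (n : ℝ) ^ ℓ) := by
      rw [← Real.exp_add, neg_div]
      exact Real.one_le_exp (by linarith)
    have hval : ‖χ (n : ZMod q) * (ArithmeticFunction.moebius n : ℂ) *
        (((n : ℝ) ^ (-1 : ℝ) * Real.exp (-x / (n : ℝ) ^ ℓ) : ℝ) : ℂ)‖ =
        1 / (n : ℝ) * Real.exp (-x / (n : ℝ) ^ ℓ) := by
      rw [norm_mul, norm_mul, hχ, ArithmeticFunction.moebius_apply_prime hp, norm_real,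
        Real.norm_of_nonneg (by positivity), Real.rpow_neg_one]
      simp
    rw [hval, indicator_of_mem (show n ∈ {p : ℕ | p.Prime} from hp),
      Real.norm_of_nonneg (by positivity)]
    calc 1 / (n : ℝ) = 1 / (n : ℝ) * 1 := by ring
      _ ≤ 1 / (n : ℝ) * (Real.exp x * Real.exp (-x / (n : ℝ) ^ ℓ)) := by gcongr
      _ = _ := by ring
  · rw [indicator_of_notMem (show n ∉ {p : ℕ | p.Prime} from hp), norm_zero]
    positivity

/-- The bound on `P` for `k > 1` and small `ε`. -/
lemma exists_norm_P_le {q : ℕ} [NeZero q] {χ : DirichletCharacter ℂ q} (hχ : χ.IsPrimitive)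
    {k ℓ ε : ℝ} (hk : 1 < k) (hℓ : 0 < ℓ)
    (hGRH : ∀ ρ : ℂ, DirichletCharacter.LFunction χ ρ = 0 → 0 < ρ.re → ρ.re < 1 →
      ρ.re = 1 / 2) (hε : 0 < ε) (hεℓ : ℓ * ε ≤ 1 / 4) :
    ∃ C > 0, ∀ x ≥ (1 : ℝ), ‖P χ k ℓ x‖ ≤ C * x ^ (-(k / ℓ) + 1 / (2 * ℓ) + ε) := by
  obtain ⟨W, hWd, hWL, hWb⟩ := exists_continuation_LSeries_mul_moebius hχ hGRH
  obtain ⟨C₁, hC₁, N, hW⟩ := hWb (ℓ * ε) (by positivity) k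
  set c₀ : ℝ := (k - 1) / (2 * ℓ) with hc₀
  set c : ℝ := k / ℓ - 1 / (2 * ℓ) - ε with hc
  have hℓc₀ : ℓ * c₀ = (k - 1) / 2 := by rw [hc₀]; field_simp
  have hℓc : ℓ * c = k - 1 / 2 - ℓ * ε := by rw [hc]; field_simp
  have hc₀pos : 0 < c₀ := div_pos (by linarith) (by linarith)
  have hc₀c : c₀ ≤ c := le_of_mul_le_mul_left (by rw [hℓc₀, hℓc]; linarith) hℓ
  obtain ⟨C₂, hC₂, hΓ⟩ := exists_norm_Gamma_le (N + 2) (b := c) hc₀pos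
  set G : ℂ → ℂ := fun s => Gamma s * W (k - ℓ * s) with hG
  set D : ℝ := C₂ * (C₁ * (1 + k + ℓ) ^ N) with hD
  have hD0 : 0 < D := by positivity
  have hre : ∀ s : ℂ, (k - ℓ * s : ℂ).re = k - ℓ * s.re := fun s => by simp
  have hstrip : ∀ s : ℂ, c₀ ≤ s.re → s.re ≤ c →
      1 / 2 + ℓ * ε ≤ (k - ℓ * s : ℂ).re ∧ (k - ℓ * s : ℂ).re ≤ k := by
    intro s h1 h2
    rw [hre]
    have h3 := mul_le_mul_of_nonneg_left h2 hℓ.le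
    have h4 : 0 ≤ ℓ * s.re := mul_nonneg hℓ.le (hc₀pos.le.trans h1)
    constructor <;> linarith
  have hGd : ∀ s : ℂ, c₀ ≤ s.re → s.re ≤ c → DifferentiableAt ℂ G s := by
    intro s h1 h2
    refine (differentiableAt_Gamma s fun m h => ?_).mul ?_
    · have h3 : s.re = -m := by simp [h]
      have : (0 : ℝ) ≤ m := m.cast_nonneg
      linarith
    · have h3 := hWd (k - ℓ * s) (by
        have := (hstrip s h1 h2).1
        have : 0 < ℓ * ε := by positivity
        linarith)
      exact DifferentiableAt.comp (f := fun s : ℂ => (k - ℓ * s : ℂ)) s h3 (by fun_prop)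
  have hGb : ∀ s : ℂ, c₀ ≤ s.re → s.re ≤ c → ‖G s‖ ≤ D / (1 + ‖s‖) ^ 2 := by
    intro s h1 h2
    obtain ⟨h3, h4⟩ := hstrip s h1 h2
    have h5 : 1 + ‖(k - ℓ * s : ℂ)‖ ≤ (1 + k + ℓ) * (1 + ‖s‖) := by
      have := norm_sub_le (k : ℂ) (ℓ * s)
      rw [norm_mul, norm_real, norm_real, Real.norm_of_nonneg (by linarith),
        Real.norm_of_nonneg hℓ.le] at this
      nlinarith [norm_nonneg s]
    calc ‖G s‖ = ‖Gamma s‖ * ‖W (k - ℓ * s)‖ := norm_mul _ _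
      _ ≤ C₂ / (1 + ‖s‖) ^ (N + 2) * (C₁ * ((1 + k + ℓ) * (1 + ‖s‖)) ^ N) := by
          gcongr
          · exact hΓ s h1 h2
          · exact (hW _ h3 h4).trans (by gcongr)
      _ = _ := by
          rw [hD, mul_pow, pow_add]
          field_simp
  refine ⟨D, hD0, fun x hx => ?_⟩
  have hx0 : 0 < x := by linarith
  have hxs : ∀ s : ℂ, ‖(x : ℂ) ^ (-s)‖ = x ^ (-s.re) := fun s => by
    rw [norm_cpow_eq_rpow_re_of_pos hx0, neg_re]
  have hshift : ∫ y : ℝ, (x : ℂ) ^ (-(c₀ + y * I : ℂ)) * G (c₀ + y * I) =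
      ∫ y : ℝ, (x : ℂ) ^ (-(c + y * I : ℂ)) * G (c + y * I) := by
    refine integral_vertical_eq_of_norm_le (F := fun s => (x : ℂ) ^ (-s) * G s) hD0.le hc₀c
      (fun s h1 h2 => ?_) (fun s h1 h2 => ?_)
    · refine DifferentiableAt.mul ?_ (hGd s h1 h2)
      exact DifferentiableAt.const_cpow (by fun_prop) (.inl (ofReal_ne_zero.mpr hx0.ne'))
    · rw [norm_mul, hxs]
      refine (mul_le_of_le_one_left (norm_nonneg _) ?_).trans (hGb s h1 h2)
      exact Real.rpow_le_one_of_one_le_of_nonpos hx (by linarith)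
  have hP : P χ k ℓ x =
      (1 / (2 * Real.pi)) • ∫ y : ℝ, (x : ℂ) ^ (-(c + y * I : ℂ)) * G (c + y * I) := by
    rw [P_eq_integral χ hc₀pos (by rw [hℓc₀]; linarith) hx0, ← hshift]
    congr 2
    ext y
    simp only [hG]
    rw [hWL _ (by rw [hre]; simp [hℓc₀]; linarith)]
  have hint : ‖∫ y : ℝ, (x : ℂ) ^ (-(c + y * I : ℂ)) * G (c + y * I)‖ ≤
      x ^ (-c) * (D * Real.pi) := by
    rw [← integral_univ_inv_one_add_sq, ← integral_const_mul, ← integral_const_mul]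
    refine norm_integral_le_of_norm_le ((integrable_inv_one_add_sq.const_mul _).const_mul _)
      (.of_forall fun y => ?_)
    rw [norm_mul, hxs]
    have h1 := (hGb (c + y * I) (by simpa using hc₀c) (by simp)).trans
      (div_one_add_norm_sq_le hD0.le c y)
    simp only [add_re, ofReal_re, re_ofReal_mul, I_re, mul_zero, add_zero]
    gcongr
  have hexp : -(k / ℓ) + 1 / (2 * ℓ) + ε = -c := by rw [hc]; ring
  rw [hP, norm_smul, hexp, Real.norm_of_nonneg (by positivity)]
  have hxc : 0 < x ^ (-c) := by positivity
  calc 1 / (2 * Real.pi) * _ ≤ 1 / (2 * Real.pi) * (x ^ (-c) * (D * Real.pi)) := by gcongr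
    _ = D * x ^ (-c) / 2 := by field_simp
    _ ≤ D * x ^ (-c) := by
      have : 0 < D * x ^ (-c) := by positivity
      linarith

theorem GRH_implies_P_bound {q : ℕ} [NeZero q] (hq : 0 < q)
    (χ : DirichletCharacter ℂ q) (hχ : χ.IsPrimitive)
    (k ℓ : ℝ) (hk : 1 ≤ k) (hℓ : 0 < ℓ)
    (hGRH : ∀ ρ : ℂ, DirichletCharacter.LFunction χ ρ = 0 → 0 < ρ.re → ρ.re < 1 →
      ρ.re = 1 / 2) :
    ∀ ε > (0 : ℝ), ∃ C > (0 : ℝ), ∃ x₀ > (0 : ℝ), ∀ x ≥ x₀,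
      ‖P χ k ℓ x‖ ≤ C * x ^ (-(k / ℓ) + 1 / (2 * ℓ) + ε) := by
  intro ε hε
  rcases hk.eq_or_lt with rfl | hk
  · refine ⟨1, one_pos, 1, one_pos, fun x hx => ?_⟩
    have hx0 : 0 < x := by linarith
    rw [P_one_eq_zero χ hℓ hx0.le, norm_zero]
    positivity
  · have hε' : 0 < min ε (1 / (4 * ℓ)) := by positivity
    obtain ⟨C, hC, h⟩ := exists_norm_P_le hχ hk hℓ hGRH hε' (by
      calc ℓ * min ε (1 / (4 * ℓ)) ≤ ℓ * (1 / (4 * ℓ)) := by gcongr; exact min_le_right _ _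
        _ = 1 / 4 := by field_simp)
    refine ⟨C, hC, 1, one_pos, fun x hx => (h x hx).trans ?_⟩
    gcongr
    exact min_le_left _ _
end

section
/- Let q be a positive integer, let χ be a Dirichlet character modulo q, and let k ≥ 1 and ℓ > 0 be real numbers. Suppose that for every ε > 0 there exists C > 0 such that |Σ_{1 ≤ n ≤ x} χ(n)μ(n)| ≤ C·x^{1/2+ε} for all real x ≥ 1. Then for every ε > 0 there exist C' > 0 and x₀ > 0 such that |P_{k,ℓ,χ}(x)| ≤ C'·x^{−k/ℓ + 1/(2ℓ) + ε} for all x ≥ x₀. -/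
open Complex

/-- Summation by parts against the partial sums of `a`. -/
theorem sum_range_mul_eq_partialSum (a f : ℕ → ℂ) (N : ℕ) :
    ∑ n ∈ Finset.range (N + 1), a n * f n =
      (∑ n ∈ Finset.range (N + 1), a n) * f N +
        ∑ n ∈ Finset.range N, (∑ m ∈ Finset.range (n + 1), a m) * (f n - f (n + 1)) := by
  induction N with
  | zero => simp
  | succ N ih =>
    rw [Finset.sum_range_succ, ih, Finset.sum_range_succ a (N + 1),
      Finset.sum_range_succ (fun n => (∑ m ∈ Finset.range (n + 1), a m) * (f n - f (n + 1))) N]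
    ring

theorem rpow_le_mul_exp {a u : ℝ} (ha : 0 ≤ a) (hu : 0 ≤ u) :
    u ^ a ≤ (a + 1) ^ a * Real.exp u := by
  have h1 : 0 < a + 1 := by linarith
  have h2 : u ≤ (a + 1) * Real.exp (u / (a + 1)) := by
    have := Real.add_one_le_exp (u / (a + 1))
    rw [← div_le_iff₀' h1]
    linarith
  calc u ^ a ≤ ((a + 1) * Real.exp (u / (a + 1))) ^ a := Real.rpow_le_rpow hu h2 ha
    _ = (a + 1) ^ a * Real.exp (u / (a + 1) * a) := by
      rw [Real.mul_rpow h1.le (Real.exp_pos _).le, Real.exp_mul]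
    _ ≤ (a + 1) ^ a * Real.exp u := by
      gcongr
      rw [div_mul_eq_mul_div, div_le_iff₀ h1]
      nlinarith

theorem exists_linear_mul_exp_neg_le (k ℓ A : ℝ) (hk : 0 < k) (hℓ : 0 ≤ ℓ) (hA : 0 ≤ A) :
    ∃ K > 0, ∀ u > 0, (k + ℓ * u) * Real.exp (-u) ≤ K * u ^ (-A) := by
  have hA1 : 0 < A + 1 := by linarith
  have hA2 : 0 < A + 1 + 1 := by linarith
  refine ⟨k * (A + 1) ^ A + ℓ * (A + 1 + 1) ^ (A + 1), by positivity, fun u hu => ?_⟩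
  have h1 := rpow_le_mul_exp hA hu.le
  have h2 := rpow_le_mul_exp hA1.le hu.le
  have h3 : u ^ (A + 1) = u ^ A * u := Real.rpow_add_one hu.ne' A
  have h4 : 0 < u ^ A := by positivity
  rw [Real.rpow_neg hu.le, Real.exp_neg, ← div_eq_mul_inv, ← div_eq_mul_inv,
    div_le_div_iff₀ (Real.exp_pos u) h4]
  have h5 := mul_le_mul_of_nonneg_left h1 hk.le
  have h6 := mul_le_mul_of_nonneg_left h2 hℓ
  rw [h3] at h6
  linarith

theorem div_rpow_rpow_neg {x t : ℝ} (hx : 0 < x) (ht : 0 < t) (ℓ A : ℝ) :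
    (x / t ^ ℓ) ^ (-A) = x ^ (-A) * t ^ (ℓ * A) := by
  rw [div_eq_mul_inv, ← Real.rpow_neg ht.le, Real.mul_rpow hx.le (by positivity),
    ← Real.rpow_mul ht.le]
  congr 2
  ring

theorem hasDerivAt_rpow_neg_mul_exp (k ℓ x : ℝ) {t : ℝ} (ht : 0 < t) :
    HasDerivAt (fun t : ℝ => t ^ (-k) * Real.exp (-x / t ^ ℓ))
      (t ^ (-k - 1) * ((-k + ℓ * (x / t ^ ℓ)) * Real.exp (-(x / t ^ ℓ)))) t := by
  have h0 : t ^ ℓ ≠ 0 := by positivity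
  have h1 : HasDerivAt (fun t : ℝ => t ^ (-k)) (-k * t ^ (-k - 1)) t :=
    Real.hasDerivAt_rpow_const (Or.inl ht.ne')
  have h2 : HasDerivAt (fun t : ℝ => t ^ ℓ) (ℓ * t ^ (ℓ - 1)) t :=
    Real.hasDerivAt_rpow_const (Or.inl ht.ne')
  have h3 := h1.mul (((hasDerivAt_const t (-x)).div h2 h0).exp)
  refine h3.congr_deriv ?_
  simp only [Pi.div_apply]
  rw [Real.rpow_sub_one ht.ne', Real.rpow_sub_one ht.ne', neg_div]
  field_simp
  ring

section Weight

variable {k ℓ A K x : ℝ}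

theorem abs_deriv_rpow_neg_mul_exp_le (hk : 0 < k) (hℓ : 0 ≤ ℓ)
    (hK : ∀ u > 0, (k + ℓ * u) * Real.exp (-u) ≤ K * u ^ (-A)) (hx : 0 < x) {t : ℝ}
    (ht : 0 < t) :
    |t ^ (-k - 1) * ((-k + ℓ * (x / t ^ ℓ)) * Real.exp (-(x / t ^ ℓ)))| ≤
      K * x ^ (-A) * t ^ (-k - 1 + ℓ * A) := by
  have hu : 0 < x / t ^ ℓ := by positivity
  have h1 : |(-k + ℓ * (x / t ^ ℓ))| ≤ k + ℓ * (x / t ^ ℓ) := by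
    have : 0 ≤ ℓ * (x / t ^ ℓ) := by positivity
    rw [abs_le]
    constructor <;> linarith
  have h2 := hK _ hu
  rw [div_rpow_rpow_neg hx ht] at h2
  rw [abs_mul, abs_mul, abs_of_pos (Real.rpow_pos_of_pos ht _), Real.abs_exp]
  calc t ^ (-k - 1) * (|(-k + ℓ * (x / t ^ ℓ))| * Real.exp (-(x / t ^ ℓ)))
      ≤ t ^ (-k - 1) * (K * (x ^ (-A) * t ^ (ℓ * A))) := by
        refine mul_le_mul_of_nonneg_left ?_ (by positivity)
        exact (mul_le_mul_of_nonneg_right h1 (Real.exp_pos _).le).trans h2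
    _ = K * x ^ (-A) * t ^ (-k - 1 + ℓ * A) := by
        rw [Real.rpow_add ht]
        ring

theorem rpow_neg_mul_exp_le (hk : 1 ≤ k) (hℓ : 0 ≤ ℓ)
    (hK : ∀ u > 0, (k + ℓ * u) * Real.exp (-u) ≤ K * u ^ (-A)) (hx : 0 < x) {t : ℝ}
    (ht : 0 < t) :
    t ^ (-k) * Real.exp (-x / t ^ ℓ) ≤ K * x ^ (-A) * t ^ (-k + ℓ * A) := by
  have hu : 0 < x / t ^ ℓ := by positivity
  have h2 := hK _ hu
  rw [div_rpow_rpow_neg hx ht] at h2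
  have h1 : 1 ≤ k + ℓ * (x / t ^ ℓ) := by
    have : 0 ≤ ℓ * (x / t ^ ℓ) := by positivity
    linarith
  have h3 := le_mul_of_one_le_left (Real.exp_pos (-(x / t ^ ℓ))).le h1
  rw [neg_div, Real.rpow_add ht]
  calc t ^ (-k) * Real.exp (-(x / t ^ ℓ)) ≤ t ^ (-k) * (K * (x ^ (-A) * t ^ (ℓ * A))) := by
        gcongr
        exact h3.trans h2
    _ = _ := by ring

theorem abs_rpow_neg_mul_exp_sub_le (hk : 0 < k) (hℓ : 0 ≤ ℓ) (hK0 : 0 ≤ K)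
    (hK : ∀ u > 0, (k + ℓ * u) * Real.exp (-u) ≤ K * u ^ (-A)) (hx : 0 < x)
    (hkA : -k - 1 + ℓ * A ≤ 0) {t : ℝ} (ht : 0 < t) :
    |t ^ (-k) * Real.exp (-x / t ^ ℓ) - (t + 1) ^ (-k) * Real.exp (-x / (t + 1) ^ ℓ)| ≤
      K * x ^ (-A) * t ^ (-k - 1 + ℓ * A) := by
  have h := (convex_Icc t (t + 1)).norm_image_sub_le_of_norm_hasDerivWithin_le
    (f := fun t : ℝ => t ^ (-k) * Real.exp (-x / t ^ ℓ))
    (C := K * x ^ (-A) * t ^ (-k - 1 + ℓ * A))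
    (fun s hs => (hasDerivAt_rpow_neg_mul_exp k ℓ x (ht.trans_le hs.1)).hasDerivWithinAt)
    (fun s hs => by
      refine (abs_deriv_rpow_neg_mul_exp_le hk hℓ hK hx (ht.trans_le hs.1)).trans ?_
      exact mul_le_mul_of_nonneg_left (Real.rpow_le_rpow_of_nonpos ht hs.1 hkA) (by positivity))
    (Set.right_mem_Icc.2 (by linarith)) (Set.left_mem_Icc.2 (by linarith))
  simpa using h

end Weight

theorem summatory_bound_implies_P_bound {q : ℕ} (hq : 0 < q)
    (χ : DirichletCharacter ℂ q) (k ℓ : ℝ) (hk : 1 ≤ k) (hℓ : 0 < ℓ)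
    (hS : ∀ ε > (0 : ℝ), ∃ C > (0 : ℝ), ∀ x : ℝ, 1 ≤ x →
      ‖∑ n ∈ Finset.Icc 1 ⌊x⌋₊,
        χ (n : ZMod q) * (ArithmeticFunction.moebius n : ℂ)‖ ≤ C * x ^ (1 / 2 + ε)) :
    ∀ ε > (0 : ℝ), ∃ C' > (0 : ℝ), ∃ x₀ > (0 : ℝ), ∀ x ≥ x₀,
      ‖P χ k ℓ x‖ ≤ C' * x ^ (-(k / ℓ) + 1 / (2 * ℓ) + ε) := by
  intro ε hε
  obtain ⟨δ, hδ, hδ1, hδ2⟩ : ∃ δ > 0, 2 * δ ≤ 1 / 2 ∧ 2 * δ ≤ ε * ℓ := by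
    refine ⟨min (1 / 4) (ε * ℓ / 2), by positivity, ?_, ?_⟩
    · linarith [min_le_left (1 / 4) (ε * ℓ / 2)]
    · linarith [min_le_right (1 / 4) (ε * ℓ / 2)]
  obtain ⟨C, hC, hSC⟩ := hS δ hδ
  set a : ℕ → ℂ := fun n => χ (n : ZMod q) * (ArithmeticFunction.moebius n : ℂ) with ha
  have ha0 : a 0 = 0 := by simp [ha]
  -- The saving exponent `A` makes `n ^ (1/2 + δ)` times the increment of the weight summable.
  obtain ⟨A, hA⟩ : ∃ A, A = (k - 1 / 2 - 2 * δ) / ℓ := ⟨_, rfl⟩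
  have hA0 : 0 ≤ A := by rw [hA]; exact div_nonneg (by linarith) hℓ.le
  have hℓA : ℓ * A = k - 1 / 2 - 2 * δ := by rw [hA]; field_simp
  obtain ⟨K, hK0, hK⟩ := exists_linear_mul_exp_neg_le k ℓ A (by linarith) hℓ.le hA0
  have hpart (n : ℕ) (hn : 1 ≤ n) :
      ‖∑ m ∈ Finset.range (n + 1), a m‖ ≤ C * (n : ℝ) ^ (1 / 2 + δ) := by
    have h := hSC n (by exact_mod_cast hn)
    rw [Nat.floor_natCast] at h
    rwa [Finset.range_eq_Ico, Finset.sum_eq_sum_Ico_succ_bot (by omega), ha0, zero_add]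
  have hZ : Summable fun n : ℕ => (n : ℝ) ^ (-1 - δ) :=
    Real.summable_nat_rpow.2 (by linarith)
  have hZ0 : 0 ≤ ∑' n : ℕ, (n : ℝ) ^ (-1 - δ) := tsum_nonneg fun n => by positivity
  refine ⟨C * K * (1 + ∑' n : ℕ, (n : ℝ) ^ (-1 - δ)), by positivity, 1, one_pos,
    fun x hx1 => ?_⟩
  have hx : 0 < x := by linarith [show (1 : ℝ) ≤ x from hx1]
  have hexp : x ^ (-A) ≤ x ^ (-(k / ℓ) + 1 / (2 * ℓ) + ε) := by
    refine Real.rpow_le_rpow_of_exponent_le hx1 ?_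
    have h1 : 2 * δ / ℓ ≤ ε := (div_le_iff₀ hℓ).2 hδ2
    have h2 : -A = -(k / ℓ) + 1 / (2 * ℓ) + 2 * δ / ℓ := by rw [hA]; field_simp; ring
    linarith
  set f : ℕ → ℂ := fun n => (((n : ℝ) ^ (-k) * Real.exp (-x / (n : ℝ) ^ ℓ) : ℝ) : ℂ) with hf
  have hbound (N : ℕ) (hN : 1 ≤ N) : ‖∑ n ∈ Finset.range (N + 1), a n * f n‖ ≤
      C * K * (1 + ∑' n : ℕ, (n : ℝ) ^ (-1 - δ)) * x ^ (-A) := by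
    have hN1 : (1 : ℝ) ≤ N := by exact_mod_cast hN
    have hN0 : (0 : ℝ) < N := by linarith
    have hend : ‖(∑ n ∈ Finset.range (N + 1), a n) * f N‖ ≤ C * K * x ^ (-A) := by
      have hfN : ‖f N‖ ≤ K * x ^ (-A) * (N : ℝ) ^ (-k + ℓ * A) := by
        rw [hf, Complex.norm_real, Real.norm_of_nonneg (by positivity)]
        exact rpow_neg_mul_exp_le hk hℓ.le hK hx hN0
      rw [norm_mul]
      calc _ ≤ (C * (N : ℝ) ^ (1 / 2 + δ)) * (K * x ^ (-A) * (N : ℝ) ^ (-k + ℓ * A)) :=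
            mul_le_mul (hpart N hN) hfN (norm_nonneg _) (by positivity)
        _ = C * K * x ^ (-A) * (N : ℝ) ^ (-δ) := by
            rw [show -δ = (1 / 2 + δ) + (-k + ℓ * A) by rw [hℓA]; ring,
              Real.rpow_add hN0 (1 / 2 + δ) (-k + ℓ * A)]
            ring
        _ ≤ C * K * x ^ (-A) := mul_le_of_le_one_right (by positivity)
            (Real.rpow_le_one_of_one_le_of_nonpos hN1 (by linarith))
    have hterm (n : ℕ) : ‖(∑ m ∈ Finset.range (n + 1), a m) * (f n - f (n + 1))‖ ≤
        C * K * x ^ (-A) * (n : ℝ) ^ (-1 - δ) := by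
      rcases Nat.eq_zero_or_pos n with rfl | hn
      · simp only [zero_add, Finset.sum_range_one, ha0, zero_mul, norm_zero]
        positivity
      have hn0 : (0 : ℝ) < n := by exact_mod_cast hn
      have hfn : ‖f n - f (n + 1)‖ ≤ K * x ^ (-A) * (n : ℝ) ^ (-k - 1 + ℓ * A) := by
        simp only [hf]
        rw [← Complex.ofReal_sub, Complex.norm_real, Nat.cast_add_one]
        exact abs_rpow_neg_mul_exp_sub_le (by linarith) hℓ.le hK0.le hK hx
          (by rw [hℓA]; linarith) hn0
      rw [norm_mul]
      calc _ ≤ (C * (n : ℝ) ^ (1 / 2 + δ)) * (K * x ^ (-A) * (n : ℝ) ^ (-k - 1 + ℓ * A)) :=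
            mul_le_mul (hpart n hn) hfn (norm_nonneg _) (by positivity)
        _ = C * K * x ^ (-A) * (n : ℝ) ^ (-1 - δ) := by
            rw [show -1 - δ = (1 / 2 + δ) + (-k - 1 + ℓ * A) by rw [hℓA]; ring,
              Real.rpow_add hn0 (1 / 2 + δ) (-k - 1 + ℓ * A)]
            ring
    have hsum : ‖∑ n ∈ Finset.range N,
        (∑ m ∈ Finset.range (n + 1), a m) * (f n - f (n + 1))‖ ≤
        C * K * x ^ (-A) * ∑' n : ℕ, (n : ℝ) ^ (-1 - δ) := by
      refine (norm_sum_le_of_le _ fun n _ => hterm n).trans ?_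
      rw [← Finset.mul_sum]
      gcongr
      exact hZ.sum_le_tsum _ fun n _ => by positivity
    rw [sum_range_mul_eq_partialSum]
    refine (norm_add_le _ _).trans ((add_le_add hend hsum).trans_eq ?_)
    ring
  have hP : P χ k ℓ x = ∑' n, a n * f n := rfl
  refine le_trans ?_ (mul_le_mul_of_nonneg_left hexp (by positivity))
  rw [hP]
  by_cases hsm : Summable fun n => a n * f n
  · have hlim := ((Filter.tendsto_add_atTop_iff_nat 1).2 hsm.hasSum.tendsto_sum_nat).norm
    refine le_of_tendsto hlim ?_
    filter_upwards [Filter.eventually_ge_atTop 1] with N hN using hbound N hN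
  · rw [tsum_eq_zero_of_not_summable hsm, norm_zero]
    positivity
end

section
/- Let q be a positive integer, let χ be a primitive Dirichlet character modulo q. If every zero ρ of L(s,χ) with 0 < Re(ρ) < 1 satisfies Re(ρ) = 1/2, then for every ε > 0 there exists C > 0 such that |Σ_{1 ≤ n ≤ x} χ(n)μ(n)| ≤ C·x^{1/2+ε} for all real x ≥ 1. -/
open Complex

/-- A nonvanishing holomorphic function on a disc has a logarithm relative to its value at the
centre. -/
theorem exists_log_on_ball {F : ℂ → ℂ} {c : ℂ} {R : ℝ} (hR : 0 < R)
    (hF : DifferentiableOn ℂ F (Metric.ball c R)) (hF0 : ∀ z ∈ Metric.ball c R, F z ≠ 0) :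
    ∃ f : ℂ → ℂ, f c = 0 ∧ (∀ z ∈ Metric.ball c R, HasDerivAt f (deriv F z / F z) z) ∧
      ∀ z ∈ Metric.ball c R, F z = F c * exp (f z) := by
  have hc : c ∈ Metric.ball c R := Metric.mem_ball_self hR
  have hD : DifferentiableOn ℂ (fun z => deriv F z / F z) (Metric.ball c R) :=
    (hF.deriv Metric.isOpen_ball).div hF hF0
  obtain ⟨f, hfc, hf⟩ := hD.isExactOn_ball.with_val_at c 0
  refine ⟨f, hfc, hf, fun z hz => ?_⟩
  have hFd : ∀ x ∈ Metric.ball c R, HasDerivAt F (deriv F x) x := fun x hx =>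
    (hF.differentiableAt (Metric.isOpen_ball.mem_nhds hx)).hasDerivAt
  have hd : ∀ x ∈ Metric.ball c R, HasDerivAt (fun z => F z * exp (-f z)) 0 x := by
    intro x hx
    refine ((hFd x hx).mul (hf x hx).fun_neg.cexp).congr_deriv ?_
    have h0 := hF0 x hx
    field_simp
    ring
  have hconst : F z * exp (-f z) = F c * exp (-f c) := by
    refine Metric.isOpen_ball.is_const_of_deriv_eq_zero
      (convex_ball c R).isPreconnected (fun x hx => (hd x hx).differentiableAt.differentiableWithinAt)
      (fun x hx => (hd x hx).deriv) hz hc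
  rw [hfc, neg_zero, Complex.exp_zero, mul_one] at hconst
  rw [← hconst, mul_assoc, ← Complex.exp_add]
  simp

/-- A bound for the logarithmic derivative of a nonvanishing holomorphic function, from the
Borel–Carathéodory theorem. -/
theorem norm_logDeriv_le_of_norm_le {F : ℂ → ℂ} {c z : ℂ} {R ρ M : ℝ} (hρ : 0 < ρ) (hR : 0 < R)
    (hM : 0 < M) (hF : DifferentiableOn ℂ F (Metric.ball c R))
    (hF0 : ∀ w ∈ Metric.ball c R, F w ≠ 0)
    (hb : ∀ w ∈ Metric.ball c R, ‖F w‖ ≤ ‖F c‖ * Real.exp M)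
    (hz : dist z c ≤ R - 2 * ρ) :
    ‖deriv F z / F z‖ ≤ 2 * R / ρ ^ 2 * M := by
  have hc : c ∈ Metric.ball c R := Metric.mem_ball_self hR
  obtain ⟨f, hfc, hf, hexp⟩ := exists_log_on_ball hR hF hF0
  have hre : ∀ w ∈ Metric.ball c R, (f w).re ≤ M := by
    intro w hw
    have h1 := hb w hw
    rw [hexp w hw, norm_mul, Complex.norm_exp] at h1
    have h2 := le_of_mul_le_mul_left h1 (norm_pos_iff.mpr (hF0 c hc))
    exact Real.exp_le_exp.mp h2
  have hfdiff : DifferentiableOn ℂ f (Metric.ball c R) := fun w hw =>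
    (hf w hw).differentiableAt.differentiableWithinAt
  have hmaps : ∀ w ∈ Metric.ball (0 : ℂ) R, c + w ∈ Metric.ball c R := by
    intro w hw
    simpa [Metric.mem_ball, dist_eq_norm] using hw
  have hbound : ∀ w, dist w c ≤ R - ρ → ‖f w‖ ≤ 2 * M * R / ρ := by
    intro w hw
    have hw' : w - c ∈ Metric.ball (0 : ℂ) R := by
      rw [mem_ball_zero_iff, ← dist_eq_norm]; linarith
    have h := borelCaratheodory_zero (f := fun w => f (c + w)) hM
      (hfdiff.comp (by fun_prop) hmaps) (fun w hw => hre _ (hmaps w hw)) hR hw' (by simpa using hfc)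
    simp only [add_sub_cancel] at h
    rw [← dist_eq_norm] at h
    refine h.trans ?_
    gcongr
    · linarith
    · linarith
  rw [← (hf z (by rw [Metric.mem_ball]; linarith)).deriv]
  have hsub : Metric.closedBall z ρ ⊆ Metric.ball c R := by
    intro w hw
    rw [Metric.mem_closedBall] at hw
    rw [Metric.mem_ball]
    linarith [dist_triangle w z c]
  have := norm_deriv_le_of_forall_mem_sphere_norm_le (f := f) (c := z) (C := 2 * M * R / ρ) hρ
    (hfdiff.diffContOnCl_ball hsub) (fun w hw => hbound w (by
      rw [Metric.mem_sphere] at hw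
      linarith [dist_triangle w z c]))
  refine this.trans (le_of_eq ?_)
  field_simp

theorem one_le_log_three_add_abs (t : ℝ) : 1 ≤ Real.log (3 + |t|) := by
  rw [Real.le_log_iff_exp_le (by positivity)]
  linarith [Real.exp_one_lt_three, abs_nonneg t]

/-- On a vertical strip inside `1 / 2 < re s`, the logarithmic derivative of a nonvanishing
holomorphic function of polynomial growth is at most logarithmic in the height. -/
theorem exists_norm_logDeriv_le_log {G : ℂ → ℂ} {K c₀ : ℝ} {k : ℕ}
    (hG : DifferentiableOn ℂ G {s | 1 / 2 < s.re}) (hG0 : ∀ s : ℂ, 1 / 2 < s.re → G s ≠ 0)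
    (hK : 0 < K) (hb : ∀ s : ℂ, 1 / 2 < s.re → s.re < 4 → ‖G s‖ ≤ K * (3 + |s.im|) ^ k)
    (hc₀ : 0 < c₀) (hlow : ∀ s : ℂ, s.re = 2 → c₀ ≤ ‖G s‖) {δ : ℝ} (hδ : 0 < δ) :
    ∃ K' > 0, ∀ s : ℂ, 1 / 2 + δ ≤ s.re → s.re ≤ 2 →
      ‖deriv G s / G s‖ ≤ K' * Real.log (3 + |s.im|) := by
  set B : ℝ := |Real.log (K * 2 ^ k / c₀)| + k + 1 with hB
  refine ⟨2 * (3 / 2) / (δ / 2) ^ 2 * B, by positivity, fun s hs1 hs2 => ?_⟩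
  set ℓ := Real.log (3 + |s.im|) with hℓ
  have hℓ1 : 1 ≤ ℓ := one_le_log_three_add_abs s.im
  have hball : ∀ w ∈ Metric.ball (⟨2, s.im⟩ : ℂ) (3 / 2),
      1 / 2 < w.re ∧ w.re < 4 ∧ |w.im| ≤ |s.im| + 3 / 2 := by
    intro w hw
    rw [Metric.mem_ball, dist_eq_norm] at hw
    have h1 := (abs_re_le_norm (w - ⟨2, s.im⟩)).trans_lt hw
    have h2 := (abs_im_le_norm (w - ⟨2, s.im⟩)).trans_lt hw
    simp only [sub_re, sub_im] at h1 h2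
    rw [abs_lt] at h1
    refine ⟨by linarith, by linarith, ?_⟩
    have := abs_sub_abs_le_abs_sub w.im s.im
    linarith
  have hmain := norm_logDeriv_le_of_norm_le (F := G) (c := ⟨2, s.im⟩) (z := s) (R := 3 / 2)
    (ρ := δ / 2) (M := B * ℓ) (by positivity) (by norm_num) (by positivity)
    (hG.mono fun w hw => (hball w hw).1) (fun w hw => hG0 w (hball w hw).1) ?_ ?_
  · rw [mul_assoc]; exact hmain
  · intro w hw
    obtain ⟨h1, h2, h3⟩ := hball w hw
    have hpow : K * (3 + |w.im|) ^ k ≤ c₀ * Real.exp (B * ℓ) := by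
      have e1 : (3 + |w.im|) ^ k ≤ 2 ^ k * (3 + |s.im|) ^ k := by
        rw [← mul_pow]
        have := abs_nonneg s.im
        gcongr
        linarith
      have e2 : (3 + |s.im|) ^ k = Real.exp (k * ℓ) := by
        rw [mul_comm, Real.exp_mul, hℓ, Real.exp_log (by positivity), Real.rpow_natCast]
      have e3 : K * 2 ^ k / c₀ ≤ Real.exp ((|Real.log (K * 2 ^ k / c₀)| + 1) * ℓ) := by
        have hpos : 0 < K * 2 ^ k / c₀ := by positivity
        calc K * 2 ^ k / c₀ = Real.exp (Real.log (K * 2 ^ k / c₀)) := (Real.exp_log hpos).symm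
          _ ≤ _ := by
            apply Real.exp_le_exp.mpr
            have := le_abs_self (Real.log (K * 2 ^ k / c₀))
            nlinarith [abs_nonneg (Real.log (K * 2 ^ k / c₀))]
      calc K * (3 + |w.im|) ^ k ≤ K * (2 ^ k * (3 + |s.im|) ^ k) := by gcongr
        _ = c₀ * (K * 2 ^ k / c₀ * Real.exp (k * ℓ)) := by rw [e2]; field_simp
        _ ≤ c₀ * (Real.exp ((|Real.log (K * 2 ^ k / c₀)| + 1) * ℓ) * Real.exp (k * ℓ)) := by
          gcongr
        _ = c₀ * Real.exp (B * ℓ) := by rw [← Real.exp_add, hB]; ring_nf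
    refine (hb w h1 h2).trans (hpow.trans ?_)
    gcongr
    exact hlow _ rfl
  · have : s - ⟨2, s.im⟩ = ((s.re - 2 : ℝ) : ℂ) := by apply Complex.ext <;> simp
    rw [dist_eq_norm, this, norm_real, Real.norm_eq_abs, abs_of_nonpos (by linarith)]
    linarith

/-- Interpolation between `1 / 2 + δ` and `2` of a bound that is logarithmic on the left and
constant on the right. -/
theorem exists_norm_le_log_rpow {D : ℂ → ℂ} {K C δ : ℝ} (hδ : 0 < δ) (hδ1 : δ < 1 / 2)
    (hK : 0 < K) (hC : 0 < C)
    (hD : DifferentiableOn ℂ D {s | 1 / 2 < s.re})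
    (hlog : ∀ s : ℂ, 1 / 2 + δ ≤ s.re → s.re ≤ 2 → ‖D s‖ ≤ K * Real.log (3 + |s.im|))
    (hbdd : ∀ s : ℂ, s.re = 2 → ‖D s‖ ≤ C) :
    ∃ W > 0, ∀ s : ℂ, 1 / 2 + 2 * δ ≤ s.re → s.re ≤ 2 →
      ‖D s‖ ≤ W * Real.log (3 + |s.im|) ^ (1 - 2 * δ / 3) := by
  set W : ℝ := max 1 (max (2 * Real.exp 4 * K) (C * Real.exp 4)) with hW
  have hW1 : 1 ≤ W := le_max_left _ _
  have hWK : 2 * Real.exp 4 * K ≤ W := (le_max_left _ _).trans (le_max_right _ _)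
  have hWC : C * Real.exp 4 ≤ W := (le_max_right _ _).trans (le_max_right _ _)
  refine ⟨W, by positivity, fun s hs1 hs2 => ?_⟩
  set T := s.im with hT
  set ℓ := Real.log (3 + |T|) with hℓ
  have hℓ1 : 1 ≤ ℓ := one_le_log_three_add_abs T
  set h : ℂ → ℂ := fun w => D w * exp ((w - T * I) ^ 2) with hh
  have hexp : ∀ w : ℂ, ‖exp ((w - T * I) ^ 2)‖ = Real.exp (w.re ^ 2 - (w.im - T) ^ 2) := by
    intro w
    rw [Complex.norm_exp]
    congr 1
    simp [pow_two]
  have hstrip : ∀ w : ℂ, 1 / 2 + δ ≤ w.re → w.re ≤ 2 → ‖h w‖ ≤ W * ℓ := by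
    intro w hw1 hw2
    set u := |w.im - T| with hu
    have hu0 : 0 ≤ u := abs_nonneg _
    have hlogw : Real.log (3 + |w.im|) ≤ ℓ * (1 + u) := by
      have e1 : 3 + |w.im| ≤ (3 + |T|) * (1 + u) := by
        have := abs_sub_abs_le_abs_sub w.im T
        nlinarith [abs_nonneg T]
      calc Real.log (3 + |w.im|) ≤ Real.log ((3 + |T|) * (1 + u)) :=
            Real.log_le_log (by positivity) e1
        _ = ℓ + Real.log (1 + u) := Real.log_mul (by positivity) (by positivity)
        _ ≤ ℓ + u := by
          have := Real.log_le_sub_one_of_pos (show 0 < 1 + u by positivity)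
          linarith
        _ ≤ ℓ * (1 + u) := by nlinarith
    have hgauss : (1 + u) * Real.exp (w.re ^ 2 - (w.im - T) ^ 2) ≤ 2 * Real.exp 4 := by
      have e1 : w.re ^ 2 - (w.im - T) ^ 2 ≤ 4 - u ^ 2 := by
        rw [hu, sq_abs]; nlinarith
      have e2 : 1 + u ≤ 2 * Real.exp (u ^ 2) := by
        nlinarith [Real.add_one_le_exp (u ^ 2), sq_nonneg (u - 1 / 2)]
      calc (1 + u) * Real.exp (w.re ^ 2 - (w.im - T) ^ 2)
          ≤ (2 * Real.exp (u ^ 2)) * Real.exp (4 - u ^ 2) := by gcongr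
        _ = 2 * (Real.exp (u ^ 2) * Real.exp (4 - u ^ 2)) := by ring
        _ = 2 * Real.exp 4 := by rw [← Real.exp_add]; ring_nf
    calc ‖h w‖ = ‖D w‖ * Real.exp (w.re ^ 2 - (w.im - T) ^ 2) := by
          rw [hh]; simp only [norm_mul, hexp]
      _ ≤ (K * (ℓ * (1 + u))) * Real.exp (w.re ^ 2 - (w.im - T) ^ 2) := by
          gcongr
          exact (hlog w hw1 hw2).trans (by gcongr)
      _ = K * ℓ * ((1 + u) * Real.exp (w.re ^ 2 - (w.im - T) ^ 2)) := by ring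
      _ ≤ K * ℓ * (2 * Real.exp 4) := by gcongr
      _ = 2 * Real.exp 4 * K * ℓ := by ring
      _ ≤ W * ℓ := by gcongr
  have hright : ∀ w : ℂ, w.re = 2 → ‖h w‖ ≤ W := by
    intro w hw
    calc ‖h w‖ = ‖D w‖ * Real.exp (w.re ^ 2 - (w.im - T) ^ 2) := by
          rw [hh]; simp only [norm_mul, hexp]
      _ ≤ C * Real.exp 4 := by
          gcongr
          · exact hbdd w hw
          · rw [hw]; nlinarith [sq_nonneg (w.im - T)]
      _ ≤ W := hWC
  have hul : 1 / 2 + δ < 2 := by linarith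
  have hclos : closure (HadamardThreeLines.verticalStrip (1 / 2 + δ) 2)
      ⊆ {s : ℂ | 1 / 2 < s.re} := by
    rw [HadamardThreeLines.verticalStrip, Complex.closure_preimage_re, closure_Ioo hul.ne]
    intro w hw
    simp only [Set.mem_preimage, Set.mem_Icc] at hw
    simp only [Set.mem_ofPred_eq]
    linarith [hw.1]
  have hdh : DifferentiableOn ℂ h {s | 1 / 2 < s.re} := hD.mul (by fun_prop)
  have hkey := HadamardThreeLines.norm_le_interp_of_mem_verticalClosedStrip' (f := h) (z := s)
    (a := W * ℓ) (b := W) hul ⟨by linarith, hs2⟩ (hdh.mono hclos).diffContOnCl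
    ⟨W * ℓ, by
      rintro _ ⟨w, hw, rfl⟩
      exact hstrip w hw.1 hw.2⟩
    (fun w hw => hstrip w (le_of_eq hw.symm) (by rw [show w.re = _ from hw]; linarith))
    (fun w hw => hright w hw)
  set θ := (s.re - (1 / 2 + δ)) / (2 - (1 / 2 + δ)) with hθ
  have hθ1 : 2 * δ / 3 ≤ θ := by
    rw [hθ, le_div_iff₀ (by linarith)]
    nlinarith
  calc ‖D s‖ ≤ ‖h s‖ := by
        rw [hh]
        simp only [norm_mul, hexp]
        refine le_mul_of_one_le_right (norm_nonneg _) (Real.one_le_exp ?_)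
        nlinarith [sq_nonneg s.re, sub_self T]
    _ ≤ (W * ℓ) ^ (1 - θ) * W ^ θ := hkey
    _ = W * ℓ ^ (1 - θ) := by
        rw [Real.mul_rpow (by positivity) (by positivity), mul_right_comm,
          ← Real.rpow_add (by positivity)]
        simp
    _ ≤ W * ℓ ^ (1 - 2 * δ / 3) := by
        gcongr

theorem exists_mul_rpow_le_add {W κ η : ℝ} (hκ : κ < 1) (hη : 0 < η) :
    ∃ C : ℝ, ∀ x : ℝ, 1 ≤ x → W * x ^ κ ≤ η * x + C := by
  have hlim : Filter.Tendsto (fun x : ℝ => W * x ^ (κ - 1)) Filter.atTop (nhds (W * 0)) := by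
    have := (tendsto_rpow_neg_atTop (show 0 < 1 - κ by linarith)).const_mul W
    simpa using this
  rw [mul_zero] at hlim
  obtain ⟨X, hX⟩ := Filter.eventually_atTop.mp (hlim.eventually (ge_mem_nhds hη))
  set Y := max X 1
  refine ⟨|W| * Y ^ (max κ 0), fun x hx => ?_⟩
  have hx0 : 0 < x := by linarith
  rcases le_total Y x with h | h
  · have h1 := hX x ((le_max_left _ _).trans h)
    have h2 : W * x ^ κ = W * x ^ (κ - 1) * x := by
      rw [Real.rpow_sub_one hx0.ne']; field_simp
    have : 0 ≤ |W| * Y ^ (max κ 0) := by positivity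
    rw [h2]
    nlinarith
  · calc W * x ^ κ ≤ |W| * x ^ (max κ 0) := by
          gcongr
          · exact le_abs_self W
          · exact le_max_left _ _
      _ ≤ |W| * Y ^ (max κ 0) := by gcongr
      _ ≤ _ := by nlinarith

/-- A nonvanishing holomorphic function on `1 / 2 < re s` of polynomial growth, bounded below and
with bounded logarithmic derivative on `re s = 2`, satisfies a Lindelöf-type lower bound. -/
theorem exists_norm_inv_le_rpow {G : ℂ → ℂ} {K c₀ C : ℝ} {k : ℕ}
    (hG : DifferentiableOn ℂ G {s | 1 / 2 < s.re}) (hG0 : ∀ s : ℂ, 1 / 2 < s.re → G s ≠ 0)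
    (hK : 0 < K) (hb : ∀ s : ℂ, 1 / 2 < s.re → s.re < 4 → ‖G s‖ ≤ K * (3 + |s.im|) ^ k)
    (hc₀ : 0 < c₀) (hlow : ∀ s : ℂ, s.re = 2 → c₀ ≤ ‖G s‖)
    (hC : 0 < C) (hD2 : ∀ s : ℂ, s.re = 2 → ‖deriv G s / G s‖ ≤ C)
    {δ η : ℝ} (hδ : 0 < δ) (hδ1 : δ < 1) (hη : 0 < η) :
    ∃ B > 0, ∀ s : ℂ, 1 / 2 + δ ≤ s.re → s.re ≤ 2 → ‖(G s)⁻¹‖ ≤ B * (3 + |s.im|) ^ η := by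
  obtain ⟨K', hK', hlog⟩ := exists_norm_logDeriv_le_log hG hG0 hK hb hc₀ hlow (half_pos hδ)
  have hopen : IsOpen {s : ℂ | 1 / 2 < s.re} := isOpen_lt continuous_const continuous_re
  obtain ⟨W, hW, hpow⟩ := exists_norm_le_log_rpow (D := fun s => deriv G s / G s) (half_pos hδ)
    (by linarith) hK' hC ((hG.deriv hopen).div hG hG0) hlog hD2
  obtain ⟨A, hA⟩ := exists_mul_rpow_le_add (W := W * 2) (κ := 1 - 2 * (δ / 2) / 3) (η := η)
    (by linarith) hη
  refine ⟨c₀⁻¹ * Real.exp A, by positivity, fun s hs1 hs2 => ?_⟩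
  set ℓ := Real.log (3 + |s.im|) with hℓ
  have hℓ1 : 1 ≤ ℓ := one_le_log_three_add_abs s.im
  set c : ℂ := ⟨2, s.im⟩ with hc
  have hsub : Metric.ball c (3 / 2) ⊆ {s : ℂ | 1 / 2 < s.re} := by
    intro w hw
    rw [Metric.mem_ball, dist_eq_norm] at hw
    have h1 := (abs_re_le_norm (w - c)).trans_lt hw
    simp only [sub_re, hc] at h1
    rw [abs_lt] at h1
    simp only [Set.mem_ofPred_eq]
    linarith
  have hdist : ∀ w : ℂ, w.im = s.im → w.re ≤ 2 → dist w c = 2 - w.re := by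
    intro w hw1 hw2
    have : w - c = ((w.re - 2 : ℝ) : ℂ) := by apply Complex.ext <;> simp [hc, hw1]
    rw [dist_eq_norm, this, norm_real, Real.norm_eq_abs, abs_of_nonpos (by linarith)]
    ring
  obtain ⟨f, hfc, hf, hexp⟩ := exists_log_on_ball (F := G) (c := c) (R := 3 / 2) (by norm_num)
    (hG.mono hsub) (fun w hw => hG0 w (hsub hw))
  have hseg : ∀ w ∈ segment ℝ c s, w.im = s.im ∧ 1 / 2 + δ ≤ w.re ∧ w.re ≤ 2 := by
    rintro w ⟨a, b, ha, hb, hab, rfl⟩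
    simp only [add_im, real_smul, mul_im, ofReal_re, ofReal_im, zero_mul, add_zero, add_re, mul_re,
      sub_zero, hc]
    refine ⟨by rw [← add_mul, hab, one_mul], ?_, ?_⟩ <;> nlinarith
  have hbd : ‖f s - f c‖ ≤ W * ℓ ^ (1 - 2 * (δ / 2) / 3) * ‖s - c‖ := by
    refine (convex_segment c s).norm_image_sub_le_of_norm_hasDerivWithin_le
      (f' := fun w => deriv G w / G w) (fun w hw => ?_) (fun w hw => ?_)
      (left_mem_segment ℝ c s) (right_mem_segment ℝ c s)
    · obtain ⟨h1, h2, h3⟩ := hseg w hw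
      refine (hf w ?_).hasDerivWithinAt
      rw [Metric.mem_ball, hdist w h1 h3]
      linarith
    · obtain ⟨h1, h2, h3⟩ := hseg w hw
      have := hpow w (by linarith) h3
      rwa [h1] at this
  rw [hfc, sub_zero, ← dist_eq_norm, hdist s rfl hs2] at hbd
  have hfs : ‖f s‖ ≤ η * ℓ + A := by
    refine (hbd.trans ?_).trans (hA ℓ hℓ1)
    rw [mul_right_comm]
    gcongr
    linarith
  have hs : s ∈ Metric.ball c (3 / 2) := by
    rw [Metric.mem_ball, hdist s rfl hs2]; linarith
  rw [hexp s hs, norm_inv, norm_mul, Complex.norm_exp, mul_inv, ← Real.exp_neg]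
  have hη' : (3 + |s.im|) ^ η = Real.exp (η * ℓ) := by
    rw [Real.rpow_def_of_pos (by positivity), mul_comm]
  rw [hη', mul_assoc, ← Real.exp_add]
  gcongr
  · exact hlow c rfl
  · have := (abs_le.mp (abs_re_le_norm (f s))).1
    linarith

theorem integrable_one_add_abs_rpow {r : ℝ} (hr : 1 < r) :
    MeasureTheory.Integrable (fun t : ℝ => (1 + |t|) ^ (-r)) := by
  simpa using integrable_one_add_norm (E := ℝ) (μ := MeasureTheory.volume) (r := r) (by simpa)

theorem integrable_vertical {f : ℂ → ℂ} {a b c K r : ℝ} (hr : 1 < r)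
    (hf : DifferentiableOn ℂ f {s | a ≤ s.re ∧ s.re ≤ b})
    (hb : ∀ s : ℂ, a ≤ s.re → s.re ≤ b → ‖f s‖ ≤ K * (1 + |s.im|) ^ (-r))
    (hac : a ≤ c) (hcb : c ≤ b) :
    MeasureTheory.Integrable (fun t : ℝ => f (c + t * I)) := by
  refine ((integrable_one_add_abs_rpow hr).const_mul K).mono' ?_ (.of_forall fun t => ?_)
  · refine Continuous.aestronglyMeasurable ?_
    refine hf.continuousOn.comp_continuous (by fun_prop) fun t => ?_
    simp [hac, hcb]
  · simpa using hb (c + t * I) (by simpa) (by simpa)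

/-- Moving a vertical line of integration across a strip where the integrand is holomorphic and
decays. -/
theorem integral_vertical_eq {f : ℂ → ℂ} {a b K r : ℝ} (hab : a ≤ b) (hr : 1 < r)
    (hf : DifferentiableOn ℂ f {s | a ≤ s.re ∧ s.re ≤ b})
    (hb : ∀ s : ℂ, a ≤ s.re → s.re ≤ b → ‖f s‖ ≤ K * (1 + |s.im|) ^ (-r)) :
    ∫ t : ℝ, f (a + t * I) = ∫ t : ℝ, f (b + t * I) := by
  have hrect (T : ℝ) := integral_boundary_rect_eq_zero_of_differentiableOn f
    (⟨a, -T⟩ : ℂ) (⟨b, T⟩ : ℂ) (hf.mono (by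
      intro w hw
      have := hw.1
      simpa [Set.uIcc_of_le hab] using this))
  simp only at hrect
  have hdecay : Filter.Tendsto (fun T : ℝ => K * (1 + |T|) ^ (-r) * |b - a|) Filter.atTop
      (nhds 0) := by
    have h1 : Filter.Tendsto (fun T : ℝ => 1 + |T|) Filter.atTop Filter.atTop :=
      Filter.tendsto_atTop_add_const_left _ _ Filter.tendsto_abs_atTop_atTop
    simpa using (((tendsto_rpow_neg_atTop (by linarith : 0 < r)).comp h1).const_mul K).mul_const
      |b - a|
  have hside : ∀ T : ℝ, ‖∫ x : ℝ in a..b, f (x + T * I)‖ ≤ K * (1 + |T|) ^ (-r) * |b - a| := by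
    intro T
    refine intervalIntegral.norm_integral_le_of_norm_le_const fun x hx => ?_
    rw [Set.uIoc_of_le hab] at hx
    simpa using hb (x + T * I) (by simpa using hx.1.le) (by simpa using hx.2)
  have htop : Filter.Tendsto (fun T : ℝ => ∫ x : ℝ in a..b, f (x + T * I)) Filter.atTop
      (nhds 0) := squeeze_zero_norm hside hdecay
  have hbot : Filter.Tendsto (fun T : ℝ => ∫ x : ℝ in a..b, f (x + (-T : ℝ) * I)) Filter.atTop
      (nhds 0) := squeeze_zero_norm (fun T => hside (-T)) (by simpa only [abs_neg] using hdecay)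
  have hL := MeasureTheory.intervalIntegral_tendsto_integral
    (integrable_vertical hr hf hb le_rfl hab) Filter.tendsto_neg_atTop_atBot Filter.tendsto_id
  have hR := MeasureTheory.intervalIntegral_tendsto_integral
    (integrable_vertical hr hf hb hab le_rfl) Filter.tendsto_neg_atTop_atBot Filter.tendsto_id
  have hlim := ((hbot.sub htop).add (hR.const_smul I)).sub (hL.const_smul I)
  have hzero := tendsto_nhds_unique hlim (tendsto_const_nhds.congr fun T => (hrect T).symm)
  rw [sub_zero, zero_add, ← smul_sub, smul_eq_zero, sub_eq_zero] at hzero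
  exact (hzero.resolve_left I_ne_zero).symm

theorem one_add_abs_im_le_norm {s : ℂ} (hs : 1 / 2 ≤ s.re) : (1 + |s.im|) / 3 ≤ ‖s‖ := by
  have h1 := abs_im_le_norm s
  have h2 := (le_abs_self _).trans (abs_re_le_norm s)
  linarith

theorem norm_inv_mul_add_one_le {s : ℂ} (hs : 1 / 2 ≤ s.re) :
    ‖(s * (s + 1))⁻¹‖ ≤ 9 * (1 + |s.im|) ^ (-2 : ℝ) := by
  have h1 := one_add_abs_im_le_norm hs
  have h2 : (1 + |s.im|) / 3 ≤ ‖s + 1‖ := by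
    simpa using one_add_abs_im_le_norm (s := s + 1) (by simp; linarith)
  have hp : 0 < 1 + |s.im| := by positivity
  rw [norm_inv, norm_mul, Real.rpow_neg hp.le]
  calc (‖s‖ * ‖s + 1‖)⁻¹ ≤ ((1 + |s.im|) / 3 * ((1 + |s.im|) / 3))⁻¹ := by gcongr
    _ = _ := by
      rw [show (2 : ℝ) = ((2 : ℕ) : ℝ) by norm_num, Real.rpow_natCast]
      field_simp
      norm_num

theorem differentiableOn_inv_mul_add_one :
    DifferentiableOn ℂ (fun s : ℂ => (s * (s + 1))⁻¹) {s | 0 < s.re} := by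
  refine DifferentiableOn.inv (by fun_prop) fun s hs => ?_
  have hs' : 0 < s.re := hs
  exact mul_ne_zero (ne_zero_of_re_pos hs') (ne_zero_of_re_pos (by simp; linarith))

theorem integrable_inv_mul_add_one :
    MeasureTheory.Integrable (fun t : ℝ => (((2 : ℝ) + t * I : ℂ) * ((2 : ℝ) + t * I + 1))⁻¹) :=
  integrable_vertical (f := fun s => (s * (s + 1))⁻¹) (a := 2) (b := 2) (c := 2) (K := 9)
    (r := 2) (by norm_num)
    (differentiableOn_inv_mul_add_one.mono fun s hs => by
      have := hs.1
      simp only [Set.mem_ofPred_eq]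
      linarith)
    (fun s hs _ => norm_inv_mul_add_one_le (by linarith)) le_rfl le_rfl

/-- Perron's formula with the Riesz kernel of order one. -/
theorem integral_cpow_div_mul_add_one {u : ℝ} (hu : 0 < u) :
    ∫ t : ℝ, (u : ℂ) ^ (-((2 : ℝ) + t * I : ℂ)) * (((2 : ℝ) + t * I : ℂ) * ((2 : ℝ) + t * I + 1))⁻¹
      = 2 * Real.pi * (max (1 - u) 0 : ℝ) := by
  set f : ℝ → ℂ := fun t => (Set.Ioc 0 1).indicator (fun _ => 1 : ℝ → ℂ) t -
    (Set.Ioc 0 1).indicator (fun t => (t : ℂ) ^ (1 : ℂ) : ℝ → ℂ) t with hf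
  have hM : ∀ s : ℂ, 0 < s.re → HasMellin f s (s * (s + 1))⁻¹ := by
    intro s hs
    have h1 := hasMellin_one_Ioc hs
    have h2 := hasMellin_cpow_Ioc 1 (s := s) (by simp; linarith)
    have h3 := hasMellin_sub h1.1 h2.1
    rw [h1.2, h2.2] at h3
    have e1 := ne_zero_of_re_pos hs
    have e2 : s + 1 ≠ 0 := ne_zero_of_re_pos (by simp; linarith)
    have e3 : (s * (s + 1))⁻¹ = 1 / s - 1 / (s + 1) := by
      field_simp
      ring
    rw [e3]
    exact h3
  have hfeq : ∀ t : ℝ, 0 < t → f t = (max (1 - t) 0 : ℝ) := by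
    intro t ht
    by_cases h : t ≤ 1
    · have : t ∈ Set.Ioc (0 : ℝ) 1 := ⟨ht, h⟩
      simp [hf, this, max_eq_left (sub_nonneg.mpr h)]
    · have : t ∉ Set.Ioc (0 : ℝ) 1 := fun h' => h h'.2
      rw [max_eq_right (by linarith)]
      simp only [hf, Set.indicator_of_notMem this]
      simp
  have hcont : ContinuousAt f u := by
    have : ContinuousAt (fun t : ℝ => ((max (1 - t) 0 : ℝ) : ℂ)) u := by fun_prop
    refine this.congr ?_
    filter_upwards [lt_mem_nhds hu] with t ht using (hfeq t ht).symm
  have hmel : ∀ t : ℝ, mellin f ((2 : ℝ) + t * I) =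
      (((2 : ℝ) + t * I : ℂ) * ((2 : ℝ) + t * I + 1))⁻¹ := fun t => (hM _ (by simp)).2
  have hinv := mellinInv_mellin_eq 2 f hu (hM (2 : ℝ) (by simp)).1
    (by
      rw [VerticalIntegrable]
      simp_rw [hmel]
      exact integrable_inv_mul_add_one) hcont
  rw [mellinInv, hfeq u hu] at hinv
  simp_rw [hmel, smul_eq_mul] at hinv
  have hpi : (2 * Real.pi : ℂ) * ((1 / (2 * Real.pi) : ℝ) : ℂ) = 1 := by
    have : (Real.pi : ℂ) ≠ 0 := by exact_mod_cast Real.pi_ne_zero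
    push_cast
    field_simp
  rw [← hinv, Complex.real_smul, ← mul_assoc, hpi, one_mul]

/-- The first Riesz mean of a bounded sequence as an integral of its Dirichlet series. -/
theorem integral_LSeries_mul_cpow {a : ℕ → ℂ} (ha : ∀ n, ‖a n‖ ≤ 1) {x : ℝ} (hx : 0 < x) :
    ∫ t : ℝ, LSeries a ((2 : ℝ) + t * I) * ((x : ℂ) ^ ((2 : ℝ) + t * I + 1 : ℂ) *
        (((2 : ℝ) + t * I : ℂ) * ((2 : ℝ) + t * I + 1))⁻¹) =
      2 * Real.pi * ∑ n ∈ Finset.Icc 1 ⌊x⌋₊, a n * ((x : ℂ) - n) := by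
  have hxC : (x : ℂ) ≠ 0 := by exact_mod_cast hx.ne'
  set k : ℝ → ℂ := fun t => (((2 : ℝ) + t * I : ℂ) * ((2 : ℝ) + t * I + 1))⁻¹ with hk
  set F : ℕ → ℝ → ℂ := fun n t => LSeries.term a ((2 : ℝ) + t * I) n *
    ((x : ℂ) ^ ((2 : ℝ) + t * I + 1 : ℂ) * k t) with hF
  have hF0 : ∀ t, F 0 t = 0 := fun t => by simp [hF]
  have hFn : ∀ n : ℕ, n ≠ 0 → ∀ t, F n t =
      a n * x * (((n / x : ℝ) : ℂ) ^ (-((2 : ℝ) + t * I : ℂ)) * k t) := by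
    intro n hn t
    have hn' : (0 : ℝ) < n := by positivity
    have hnC : (n : ℂ) ≠ 0 := by exact_mod_cast hn
    have e1 : ((n / x : ℝ) : ℂ) ^ (-((2 : ℝ) + t * I : ℂ)) =
        (n : ℂ) ^ (-((2 : ℝ) + t * I : ℂ)) * (x : ℂ) ^ ((2 : ℝ) + t * I : ℂ) := by
      rw [div_eq_mul_inv, ofReal_mul, Complex.mul_cpow_ofReal_nonneg hn'.le (by positivity),
        ofReal_inv, Complex.inv_cpow _ _ (by
          rw [Complex.arg_ofReal_of_nonneg hx.le]; exact Real.pi_pos.ne), ← Complex.cpow_neg,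
        neg_neg, ofReal_natCast]
    simp only [hF]
    rw [LSeries.term_of_ne_zero hn, e1, Complex.cpow_add _ _ hxC, Complex.cpow_one,
      Complex.cpow_neg]
    field_simp
  have hnorm : ∀ n t, ‖F n t‖ = ‖LSeries.term a ((2 : ℝ) : ℂ) n‖ * x ^ (3 : ℝ) * ‖k t‖ := by
    intro n t
    have e1 : ‖LSeries.term a ((2 : ℝ) + t * I) n‖ = ‖LSeries.term a ((2 : ℝ) : ℂ) n‖ := by
      simp [LSeries.norm_term_eq]
    have e2 : ‖(x : ℂ) ^ ((2 : ℝ) + t * I + 1 : ℂ)‖ = x ^ (3 : ℝ) := by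
      rw [Complex.norm_cpow_eq_rpow_re_of_pos hx]
      congr 1
      simp
      norm_num
    simp only [hF]
    rw [norm_mul, norm_mul, e1, e2, mul_assoc]
  have hkint : MeasureTheory.Integrable k := integrable_inv_mul_add_one
  have hint : ∀ n, MeasureTheory.Integrable (F n) := by
    intro n
    refine (hkint.norm.const_mul (‖LSeries.term a ((2 : ℝ) : ℂ) n‖ * x ^ (3 : ℝ))).mono' ?_
      (.of_forall fun t => (hnorm n t).le)
    rcases eq_or_ne n 0 with rfl | hn
    · rw [show F 0 = fun _ => 0 from funext hF0]
      exact MeasureTheory.aestronglyMeasurable_const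
    · have hne : ((n / x : ℝ) : ℂ) ≠ 0 := by
        have : (n / x : ℝ) ≠ 0 := by positivity
        exact_mod_cast this
      have : F n = fun t : ℝ => a n * x *
          (((n / x : ℝ) : ℂ) ^ (-((2 : ℝ) + t * I : ℂ)) * k t) := funext (hFn n hn)
      rw [this]
      refine MeasureTheory.AEStronglyMeasurable.const_mul ?_ _
      refine MeasureTheory.AEStronglyMeasurable.mul ?_ hkint.aestronglyMeasurable
      refine Continuous.aestronglyMeasurable ?_
      exact Continuous.const_cpow (by fun_prop) (Or.inl hne)
  have hsum2 : LSeriesSummable a ((2 : ℝ) : ℂ) :=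
    LSeriesSummable_of_bounded_of_one_lt_re (m := 1) (fun n _ => ha n) (by simp)
  have hsummable : Summable fun n => ∫ t, ‖F n t‖ := by
    simp_rw [hnorm, MeasureTheory.integral_const_mul]
    exact ((hsum2.norm.mul_right _).mul_right _)
  have hH := MeasureTheory.hasSum_integral_of_summable_integral_norm hint hsummable
  have hlhs : ∫ t, ∑' n, F n t = ∫ t : ℝ, LSeries a ((2 : ℝ) + t * I) *
      ((x : ℂ) ^ ((2 : ℝ) + t * I + 1 : ℂ) * k t) := by
    refine MeasureTheory.integral_congr_ae (.of_forall fun t => ?_)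
    simp only [hF, LSeries, tsum_mul_right]
  have hterm : ∀ n, ∫ t, F n t =
      if n ∈ Finset.Icc 1 ⌊x⌋₊ then 2 * Real.pi * (a n * ((x : ℂ) - n)) else 0 := by
    intro n
    rcases eq_or_ne n 0 with rfl | hn
    · simp [hF0]
    · simp_rw [hFn n hn]
      rw [MeasureTheory.integral_const_mul, integral_cpow_div_mul_add_one (by positivity)]
      by_cases h : n ≤ ⌊x⌋₊
      · have hnx : (n : ℝ) ≤ x := (Nat.le_floor_iff hx.le).mp h
        rw [if_pos (Finset.mem_Icc.mpr ⟨Nat.one_le_iff_ne_zero.mpr hn, h⟩),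
          max_eq_left (sub_nonneg.mpr ((div_le_one hx).mpr hnx))]
        push_cast
        field_simp
      · have hnx : x < n := (Nat.floor_lt hx.le).mp (not_le.mp h)
        rw [if_neg (fun h' => h (Finset.mem_Icc.mp h').2),
          max_eq_right (sub_nonpos.mpr ((one_le_div hx).mpr hnx.le))]
        simp
  rw [← hlhs]
  refine hH.unique ?_
  simp_rw [hterm]
  rw [Finset.mul_sum]
  rw [← Finset.sum_congr rfl fun n hn => if_pos (c := n ∈ Finset.Icc 1 ⌊x⌋₊) (e := (0 : ℂ)) hn]
  exact hasSum_sum_of_ne_finset_zero fun n hn => if_neg hn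

theorem norm_cpow_sub_cpow_le {s : ℂ} (hs : 0 < s.re) {x y : ℝ} (hx : 0 < x) (hxy : x ≤ y) :
    ‖(y : ℂ) ^ (s + 1) - (x : ℂ) ^ (s + 1)‖ ≤ ‖s + 1‖ * y ^ s.re * (y - x) := by
  have hs1 : s + 1 ≠ 0 := ne_zero_of_re_pos (by simp; linarith)
  have h := (convex_Icc x y).norm_image_sub_le_of_norm_hasDerivWithin_le
    (f := fun u : ℝ => (u : ℂ) ^ (s + 1)) (f' := fun u : ℝ => (s + 1) * (u : ℂ) ^ (s + 1 - 1))
    (C := ‖s + 1‖ * y ^ s.re)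
    (fun u hu => (hasDerivAt_ofReal_cpow_const (hx.trans_le hu.1).ne' hs1).hasDerivWithinAt)
    (fun u hu => by
      have hu0 : 0 < u := hx.trans_le hu.1
      rw [norm_mul, add_sub_cancel_right, Complex.norm_cpow_eq_rpow_re_of_pos hu0]
      gcongr
      exact hu.2)
    (Set.left_mem_Icc.mpr hxy) (Set.right_mem_Icc.mpr hxy)
  rwa [Real.norm_eq_abs, abs_of_nonneg (sub_nonneg.mpr hxy)] at h

/-- Interpolation between the mean value bound and the trivial bound. -/
theorem norm_cpow_sub_cpow_le_interp {s : ℂ} (hs : 1 / 2 ≤ s.re) {x y δ : ℝ} (hx : 1 ≤ x)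
    (hxy : 1 ≤ y - x) (hδ : 0 < δ) (hδ1 : δ < 1) :
    ‖(y : ℂ) ^ (s + 1) - (x : ℂ) ^ (s + 1)‖ ≤
      (y - x) * ‖s + 1‖ * (6 * y ^ (s.re + δ) * (1 + |s.im|) ^ (-δ)) := by
  have hy : 0 < y := by linarith
  have hx0 : 0 < x := by linarith
  have hs1 : (1 + |s.im|) / 3 ≤ ‖s + 1‖ := by
    simpa using one_add_abs_im_le_norm (s := s + 1) (by simp; linarith)
  have hp : 0 < 1 + |s.im| := by positivity
  have hs1' : 0 < ‖s + 1‖ := lt_of_lt_of_le (by positivity) hs1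
  have hh : 0 < y - x := by linarith
  set v := ‖(y : ℂ) ^ (s + 1) - (x : ℂ) ^ (s + 1)‖ with hv
  have hv0 : 0 ≤ v := norm_nonneg _
  have h1 : v ≤ ‖s + 1‖ * y ^ s.re * (y - x) :=
    norm_cpow_sub_cpow_le (by linarith) hx0 (by linarith)
  have h2 : v ≤ 2 * (y ^ s.re * y) := by
    have e1 : ‖(y : ℂ) ^ (s + 1)‖ = y ^ s.re * y := by
      rw [Complex.norm_cpow_eq_rpow_re_of_pos hy, add_re, one_re, Real.rpow_add_one hy.ne']
    have e2 : ‖(x : ℂ) ^ (s + 1)‖ ≤ y ^ s.re * y := by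
      rw [Complex.norm_cpow_eq_rpow_re_of_pos hx0, add_re, one_re, ← Real.rpow_add_one hy.ne']
      exact Real.rpow_le_rpow hx0.le (by linarith) (by linarith)
    linarith [norm_sub_le ((y : ℂ) ^ (s + 1)) ((x : ℂ) ^ (s + 1))]
  have hsplit : v = v ^ (1 - δ) * v ^ δ := by
    rcases hv0.eq_or_lt with h | h
    · rw [← h, Real.zero_rpow hδ.ne', mul_zero]
    · rw [← Real.rpow_add h]; simp
  have hpow : ((y - x) * ‖s + 1‖) ^ (-δ) ≤ 3 * (1 + |s.im|) ^ (-δ) := by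
    calc ((y - x) * ‖s + 1‖) ^ (-δ) ≤ ((1 + |s.im|) / 3) ^ (-δ) := by
          apply Real.rpow_le_rpow_of_nonpos (by positivity) _ (by linarith)
          nlinarith
      _ = 3 ^ δ * (1 + |s.im|) ^ (-δ) := by
          rw [Real.div_rpow hp.le (by norm_num), Real.rpow_neg (by norm_num : (0 : ℝ) ≤ 3)]
          field_simp
      _ ≤ 3 * (1 + |s.im|) ^ (-δ) := by
          gcongr
          calc (3 : ℝ) ^ δ ≤ 3 ^ (1 : ℝ) := by gcongr; norm_num
            _ = 3 := Real.rpow_one 3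
  calc v = v ^ (1 - δ) * v ^ δ := hsplit
    _ ≤ (‖s + 1‖ * y ^ s.re * (y - x)) ^ (1 - δ) * (2 * (y ^ s.re * y)) ^ δ := by
        gcongr
    _ = ((y - x) * ‖s + 1‖ * y ^ s.re) ^ (1 - δ) * (2 ^ δ * ((y ^ s.re) ^ δ * y ^ δ)) := by
        rw [show ‖s + 1‖ * y ^ s.re * (y - x) = (y - x) * ‖s + 1‖ * y ^ s.re by ring,
          Real.mul_rpow (x := 2) (by norm_num) (by positivity),
          Real.mul_rpow (x := y ^ s.re) (y := y) (by positivity) hy.le]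
    _ = ((y - x) * ‖s + 1‖) * ((y - x) * ‖s + 1‖) ^ (-δ) * 2 ^ δ *
          (((y ^ s.re) ^ (1 - δ) * (y ^ s.re) ^ δ) * y ^ δ) := by
        have e : ((y - x) * ‖s + 1‖) ^ (1 - δ) =
            ((y - x) * ‖s + 1‖) * ((y - x) * ‖s + 1‖) ^ (-δ) := by
          rw [show (1 - δ : ℝ) = 1 + -δ by ring, Real.rpow_add (by positivity), Real.rpow_one]
        rw [Real.mul_rpow (x := (y - x) * ‖s + 1‖) (by positivity) (by positivity), e]
        ring
    _ = ((y - x) * ‖s + 1‖) * ((y - x) * ‖s + 1‖) ^ (-δ) * 2 ^ δ * y ^ (s.re + δ) := by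
        rw [← Real.rpow_add (by positivity), sub_add_cancel, Real.rpow_one, Real.rpow_add hy]
    _ ≤ ((y - x) * ‖s + 1‖) * (3 * (1 + |s.im|) ^ (-δ)) * 2 * y ^ (s.re + δ) := by
        have : (2 : ℝ) ^ δ ≤ 2 := by
          calc (2 : ℝ) ^ δ ≤ 2 ^ (1 : ℝ) := by gcongr; norm_num
            _ = 2 := Real.rpow_one 2
        gcongr
    _ = _ := by ring

/-- A partial sum of a bounded sequence is controlled by a difference of first Riesz means. -/
theorem mul_norm_sum_le {a : ℕ → ℂ} (ha : ∀ n, ‖a n‖ ≤ 1) {x y : ℝ} (hx : 0 ≤ x) (hxy : x ≤ y) :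
    (y - x) * ‖∑ n ∈ Finset.Icc 1 ⌊x⌋₊, a n‖ ≤
      ‖(∑ n ∈ Finset.Icc 1 ⌊y⌋₊, a n * ((y : ℂ) - n)) -
        ∑ n ∈ Finset.Icc 1 ⌊x⌋₊, a n * ((x : ℂ) - n)‖ + (y - x) * (y - x + 1) := by
  have hfl : ⌊x⌋₊ ≤ ⌊y⌋₊ := Nat.floor_le_floor hxy
  have hsplit : ∑ n ∈ Finset.Icc 1 ⌊y⌋₊, a n * ((y : ℂ) - n) =
      ∑ n ∈ Finset.Icc 1 ⌊x⌋₊, a n * ((y : ℂ) - n) +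
        ∑ n ∈ Finset.Ioc ⌊x⌋₊ ⌊y⌋₊, a n * ((y : ℂ) - n) := by
    exact (Finset.sum_Ioc_consecutive (fun n : ℕ => a n * ((y : ℂ) - n)) (Nat.zero_le ⌊x⌋₊)
      hfl).symm
  set E := ∑ n ∈ Finset.Ioc ⌊x⌋₊ ⌊y⌋₊, a n * ((y : ℂ) - n) with hE
  have hEb : ‖E‖ ≤ (y - x) * (y - x + 1) := by
    have h1 : ‖E‖ ≤ (Finset.Ioc ⌊x⌋₊ ⌊y⌋₊).card • (y - x) := by
      refine (norm_sum_le _ _).trans (Finset.sum_le_card_nsmul _ _ _ fun n hn => ?_)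
      rw [Finset.mem_Ioc] at hn
      have h1 : x < n := (Nat.floor_lt hx).mp hn.1
      have h2 : (n : ℝ) ≤ y := (Nat.le_floor_iff (hx.trans hxy)).mp hn.2
      have h3 : ‖(y : ℂ) - n‖ = y - n := by
        rw [← ofReal_natCast, ← ofReal_sub, norm_real, Real.norm_eq_abs,
          abs_of_nonneg (by linarith)]
      rw [norm_mul, h3]
      nlinarith [ha n, norm_nonneg (a n)]
    rw [Nat.card_Ioc, nsmul_eq_mul, Nat.cast_sub hfl] at h1
    have h2 := Nat.floor_le (hx.trans hxy)
    have h3 := Nat.lt_floor_add_one x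
    nlinarith
  have hdiff : (∑ n ∈ Finset.Icc 1 ⌊y⌋₊, a n * ((y : ℂ) - n)) -
      ∑ n ∈ Finset.Icc 1 ⌊x⌋₊, a n * ((x : ℂ) - n) =
      ((y - x : ℝ) : ℂ) * ∑ n ∈ Finset.Icc 1 ⌊x⌋₊, a n + E := by
    rw [hsplit, add_sub_right_comm, ← Finset.sum_sub_distrib, Finset.mul_sum]
    congr 1
    refine Finset.sum_congr rfl fun n _ => ?_
    push_cast
    ring
  rw [hdiff]
  set S := ∑ n ∈ Finset.Icc 1 ⌊x⌋₊, a n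
  have h1 : ‖((y - x : ℝ) : ℂ) * S‖ = (y - x) * ‖S‖ := by
    rw [norm_mul, norm_real, Real.norm_eq_abs, abs_of_nonneg (by linarith)]
  have h2 := norm_sub_le (((y - x : ℝ) : ℂ) * S + E) E
  rw [add_sub_cancel_right, h1] at h2
  linarith

/-- If the Dirichlet series of a bounded sequence extends holomorphically to `1 / 2 < re s` with
subpolynomial growth, its partial sums are `O(x ^ (1 / 2 + ε))`. -/
theorem exists_norm_sum_le_rpow {a : ℕ → ℂ} (ha : ∀ n, ‖a n‖ ≤ 1) {A : ℂ → ℂ}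
    (hA : DifferentiableOn ℂ A {s | 1 / 2 < s.re}) (hAL : ∀ s : ℂ, s.re = 2 → A s = LSeries a s)
    (hgrowth : ∀ δ η : ℝ, 0 < δ → δ < 1 → 0 < η → ∃ B > 0, ∀ s : ℂ,
      1 / 2 + δ ≤ s.re → s.re ≤ 2 → ‖A s‖ ≤ B * (3 + |s.im|) ^ η) {ε : ℝ} (hε : 0 < ε) :
    ∃ C > (0 : ℝ), ∀ x : ℝ, 1 ≤ x →
      ‖∑ n ∈ Finset.Icc 1 ⌊x⌋₊, a n‖ ≤ C * x ^ (1 / 2 + ε) := by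
  set δ : ℝ := min (ε / 2) (1 / 2) with hδdef
  have hδ : 0 < δ := by positivity
  have hδ1 : δ < 1 := (min_le_right _ _).trans_lt (by norm_num)
  have hδε : 2 * δ ≤ ε := by linarith [min_le_left (ε / 2) (1 / 2 : ℝ)]
  set σ : ℝ := 1 / 2 + δ with hσ
  set k : ℂ → ℂ := fun s => (s * (s + 1))⁻¹ with hk
  have hgrow' : ∀ η : ℝ, 0 < η → η ≤ 1 → ∃ B > 0, ∀ s : ℂ, σ ≤ s.re → s.re ≤ 2 →
      ‖A s‖ ≤ B * (1 + |s.im|) ^ η := by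
    intro η hη hη1
    obtain ⟨B, hB, h⟩ := hgrowth δ η hδ hδ1 hη
    refine ⟨3 * B, by positivity, fun s h1 h2 => (h s h1 h2).trans ?_⟩
    calc B * (3 + |s.im|) ^ η ≤ B * (3 * (1 + |s.im|)) ^ η := by
          gcongr
          linarith [abs_nonneg s.im]
      _ = B * (3 ^ η * (1 + |s.im|) ^ η) := by rw [Real.mul_rpow (by norm_num) (by positivity)]
      _ ≤ B * (3 ^ (1 : ℝ) * (1 + |s.im|) ^ η) := by
          gcongr
          norm_num
      _ = 3 * B * (1 + |s.im|) ^ η := by rw [Real.rpow_one]; ring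
  obtain ⟨B₁, hB₁, hA₁⟩ := hgrow' (1 / 2) (by norm_num) (by norm_num)
  obtain ⟨B₂, hB₂, hA₂⟩ := hgrow' (δ / 2) (by positivity) (by linarith)
  set f : ℝ → ℂ → ℂ := fun x s => A s * ((x : ℂ) ^ (s + 1) * k s) with hf
  have hfd : ∀ x : ℝ, 1 ≤ x → DifferentiableOn ℂ (f x) {s | σ ≤ s.re ∧ s.re ≤ 2} := by
    intro x hx
    have hx0 : (x : ℂ) ≠ 0 := by
      have : x ≠ 0 := by linarith
      exact_mod_cast this
    have h1 : {s : ℂ | σ ≤ s.re ∧ s.re ≤ 2} ⊆ {s | 1 / 2 < s.re} := fun s hs => by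
      have := hs.1
      simp only [Set.mem_ofPred_eq]
      linarith
    have h2 : {s : ℂ | σ ≤ s.re ∧ s.re ≤ 2} ⊆ {s | 0 < s.re} := fun s hs => by
      have := hs.1
      simp only [Set.mem_ofPred_eq]
      linarith
    refine (hA.mono h1).mul (DifferentiableOn.mul ?_ (differentiableOn_inv_mul_add_one.mono h2))
    exact DifferentiableOn.const_cpow (by fun_prop) (Or.inl hx0)
  have hfb : ∀ x : ℝ, 1 ≤ x → ∀ s : ℂ, σ ≤ s.re → s.re ≤ 2 →
      ‖f x s‖ ≤ B₁ * x ^ (3 : ℝ) * 9 * (1 + |s.im|) ^ (-(3 / 2) : ℝ) := by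
    intro x hx s h1 h2
    have hx0 : 0 < x := by linarith
    have hp : 0 < 1 + |s.im| := by positivity
    simp only [hf]
    rw [norm_mul, norm_mul, Complex.norm_cpow_eq_rpow_re_of_pos hx0]
    calc ‖A s‖ * (x ^ (s + 1).re * ‖k s‖)
        ≤ (B₁ * (1 + |s.im|) ^ (1 / 2 : ℝ)) * (x ^ (3 : ℝ) * (9 * (1 + |s.im|) ^ (-2 : ℝ))) := by
          gcongr
          · exact hA₁ s h1 h2
          · simp; linarith
          · exact norm_inv_mul_add_one_le (by linarith)
      _ = B₁ * x ^ (3 : ℝ) * 9 * ((1 + |s.im|) ^ (1 / 2 : ℝ) * (1 + |s.im|) ^ (-2 : ℝ)) := by ring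
      _ = _ := by rw [← Real.rpow_add hp]; norm_num
  set R : ℝ → ℂ := fun x => ∑ n ∈ Finset.Icc 1 ⌊x⌋₊, a n * ((x : ℂ) - n) with hR
  have hRint : ∀ x : ℝ, 1 ≤ x → 2 * Real.pi * R x = ∫ t : ℝ, f x (σ + t * I) := by
    intro x hx
    rw [hR, ← integral_LSeries_mul_cpow ha (by linarith),
      integral_vertical_eq (by linarith) (by norm_num) (hfd x hx) (hfb x hx)]
    refine MeasureTheory.integral_congr_ae (.of_forall fun t => ?_)
    simp only [hf, hk]
    rw [hAL _ (by simp)]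
  have hfint : ∀ x : ℝ, 1 ≤ x → MeasureTheory.Integrable fun t : ℝ => f x (σ + t * I) :=
    fun x hx => integrable_vertical (by norm_num) (hfd x hx) (hfb x hx) le_rfl (by linarith)
  set J : ℝ := ∫ t : ℝ, (1 + |t|) ^ (-(1 + δ / 2)) with hJ
  have hJ0 : 0 ≤ J := MeasureTheory.integral_nonneg fun t => by positivity
  have hdiff : ∀ x y : ℝ, 1 ≤ x → 1 ≤ y - x →
      ‖R y - R x‖ ≤ (y - x) * (18 * B₂ * y ^ (σ + δ) * J) := by
    intro x y hx hxy
    have hy : 1 ≤ y := by linarith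
    have hpt : ∀ t : ℝ, ‖f y (σ + t * I) - f x (σ + t * I)‖ ≤
        (y - x) * (18 * B₂ * y ^ (σ + δ)) * (1 + |t|) ^ (-(1 + δ / 2)) := by
      intro t
      set s : ℂ := σ + t * I with hs
      have hsre : s.re = σ := by simp [hs]
      have hsim : s.im = t := by simp [hs]
      have hp : 0 < 1 + |t| := by positivity
      have h1 := norm_cpow_sub_cpow_le_interp (s := s) (by rw [hsre]; linarith) hx hxy hδ hδ1
      have h2 := one_add_abs_im_le_norm (s := s) (by rw [hsre]; linarith)
      have h3 := hA₂ s hsre.ge (by rw [hsre]; linarith)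
      rw [hsre, hsim] at h1
      rw [hsim] at h2 h3
      have hs0 : 0 < ‖s‖ := lt_of_lt_of_le (by positivity) h2
      have hs1 : 0 < ‖s + 1‖ := by
        rw [norm_pos_iff]
        exact ne_zero_of_re_pos (by rw [add_re, hsre, one_re]; linarith)
      have hyx : 0 < y - x := by linarith
      have e : f y s - f x s = A s * (((y : ℂ) ^ (s + 1) - (x : ℂ) ^ (s + 1)) * k s) := by
        simp only [hf]; ring
      rw [e, norm_mul, norm_mul]
      have hkn : ‖k s‖ = ‖s‖⁻¹ * ‖s + 1‖⁻¹ := by simp [hk, mul_comm]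
      calc ‖A s‖ * (‖(y : ℂ) ^ (s + 1) - (x : ℂ) ^ (s + 1)‖ * ‖k s‖)
          ≤ (B₂ * (1 + |t|) ^ (δ / 2)) * (((y - x) * ‖s + 1‖ *
            (6 * y ^ (σ + δ) * (1 + |t|) ^ (-δ))) * (((1 + |t|) / 3)⁻¹ * ‖s + 1‖⁻¹)) := by
            rw [hkn]
            gcongr
        _ = (y - x) * (18 * B₂ * y ^ (σ + δ)) *
            ((1 + |t|) ^ (δ / 2) * (1 + |t|) ^ (-δ) * (1 + |t|)⁻¹) := by
            field_simp
            ring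
        _ = (y - x) * (18 * B₂ * y ^ (σ + δ)) * (1 + |t|) ^ (-(1 + δ / 2)) := by
            rw [← Real.rpow_neg_one (1 + |t|), ← Real.rpow_add hp, ← Real.rpow_add hp]
            congr 2
            ring
    have hint : 2 * Real.pi * (R y - R x) = ∫ t : ℝ, (f y (σ + t * I) - f x (σ + t * I)) := by
      rw [MeasureTheory.integral_sub (hfint y hy) (hfint x hx), ← hRint y hy, ← hRint x hx]
      ring
    have hle := MeasureTheory.norm_integral_le_of_norm_le
      ((integrable_one_add_abs_rpow (r := 1 + δ / 2) (by linarith)).const_mul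
        ((y - x) * (18 * B₂ * y ^ (σ + δ)))) (.of_forall hpt)
    rw [← hint, MeasureTheory.integral_const_mul, norm_mul] at hle
    have hpi : (1 : ℝ) ≤ ‖(2 * Real.pi : ℂ)‖ := by
      rw [norm_mul, norm_real, Real.norm_eq_abs, abs_of_pos Real.pi_pos]
      norm_num
      linarith [Real.pi_gt_three]
    calc ‖R y - R x‖ ≤ ‖(2 * Real.pi : ℂ)‖ * ‖R y - R x‖ :=
          le_mul_of_one_le_left (norm_nonneg _) hpi
      _ ≤ _ := hle
      _ = _ := by rw [hJ]; ring
  refine ⟨18 * B₂ * 8 * J + 2, by positivity, fun x hx => ?_⟩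
  have hx0 : 0 < x := by linarith
  set h := Real.sqrt x with hh
  have hh1 : 1 ≤ h := Real.one_le_sqrt.mpr hx
  have hhx : h ≤ x := Real.sqrt_le_iff.mpr ⟨by linarith, by nlinarith⟩
  have hyx : x + h - x = h := by ring
  have hM := mul_norm_sum_le ha hx0.le (show x ≤ x + h by linarith)
  have hD := hdiff x (x + h) hx (by rw [hyx]; exact hh1)
  rw [hyx] at hM hD
  have hfin : ‖∑ n ∈ Finset.Icc 1 ⌊x⌋₊, a n‖ ≤ 18 * B₂ * (x + h) ^ (σ + δ) * J + (h + 1) := by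
    have : h * ‖∑ n ∈ Finset.Icc 1 ⌊x⌋₊, a n‖ ≤
        h * (18 * B₂ * (x + h) ^ (σ + δ) * J + (h + 1)) := by
      rw [mul_add]; exact hM.trans (by gcongr)
    exact le_of_mul_le_mul_left this (by linarith)
  have hmono : ∀ e : ℝ, e ≤ 1 / 2 + ε → x ^ e ≤ x ^ (1 / 2 + ε) := fun e he =>
    Real.rpow_le_rpow_of_exponent_le hx he
  have hy : (x + h) ^ (σ + δ) ≤ 8 * x ^ (1 / 2 + ε) := by
    calc (x + h) ^ (σ + δ) ≤ (2 * x) ^ (σ + δ) := by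
          gcongr
          linarith
      _ = 2 ^ (σ + δ) * x ^ (σ + δ) := Real.mul_rpow (by norm_num) hx0.le
      _ ≤ 2 ^ (3 : ℝ) * x ^ (1 / 2 + ε) :=
          mul_le_mul (Real.rpow_le_rpow_of_exponent_le (by norm_num) (by linarith))
            (hmono _ (by linarith)) (by positivity) (by positivity)
      _ = 8 * x ^ (1 / 2 + ε) := by norm_num
  have hhb : h ≤ x ^ (1 / 2 + ε) := by
    rw [hh, Real.sqrt_eq_rpow]
    exact hmono _ (by linarith)
  calc _ ≤ 18 * B₂ * (x + h) ^ (σ + δ) * J + (h + 1) := hfin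
    _ ≤ 18 * B₂ * (8 * x ^ (1 / 2 + ε)) * J + (x ^ (1 / 2 + ε) + x ^ (1 / 2 + ε)) := by
        gcongr
        linarith
    _ = _ := by ring

/-- If `∑ k ≤ n, f k = κ * n + O(1)`, then `LSeries f s - κ * s / (s - 1)` extends holomorphically
to `0 < re s`, with linear growth on vertical strips. -/
theorem exists_LSeries_eq_add {f : ℕ → ℂ} {κ : ℂ} {M : ℝ}
    (hf : ∀ n : ℕ, ‖∑ k ∈ Finset.Icc 1 n, f k - κ * n‖ ≤ M) :
    ∃ F : ℂ → ℂ, DifferentiableOn ℂ F {s | 0 < s.re} ∧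
      (∀ s : ℂ, 0 < s.re → ‖F s‖ ≤ ‖s‖ * ((M + ‖κ‖) / s.re)) ∧
      ∀ s : ℂ, 1 < s.re → LSeriesSummable f s → LSeries f s = κ * (s / (s - 1)) + F s := by
  have hM : 0 ≤ M := (norm_nonneg _).trans (hf 0)
  set E : ℝ → ℂ := fun t => ∑ k ∈ Finset.Icc 1 ⌊t⌋₊, f k - κ * t with hE
  have hEm : Measurable E := by
    refine Measurable.sub ?_ (by fun_prop)
    exact (measurable_from_nat (f := fun n : ℕ => ∑ k ∈ Finset.Icc 1 n, f k)).comp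
      Nat.measurable_floor
  have hEb : ∀ t : ℝ, 0 ≤ t → ‖E t‖ ≤ M + ‖κ‖ := by
    intro t ht
    have e : E t = (∑ k ∈ Finset.Icc 1 ⌊t⌋₊, f k - κ * ⌊t⌋₊) + κ * ((⌊t⌋₊ - t : ℝ) : ℂ) := by
      simp only [hE]; push_cast; ring
    rw [e]
    refine (norm_add_le _ _).trans (add_le_add (hf _) ?_)
    rw [norm_mul, norm_real, Real.norm_eq_abs]
    have h1 := Nat.floor_le ht
    have h2 := Nat.lt_floor_add_one t
    exact mul_le_of_le_one_right (norm_nonneg _) (abs_le.mpr ⟨by linarith, by linarith⟩)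
  set g : ℝ → ℂ := (Set.Ioi 1).indicator E with hg
  have hgm : Measurable g := hEm.indicator measurableSet_Ioi
  have hgb : ∀ t : ℝ, ‖g t‖ ≤ M + ‖κ‖ := by
    intro t
    by_cases ht : t ∈ Set.Ioi (1 : ℝ)
    · rw [hg, Set.indicator_of_mem ht]
      exact hEb t (zero_le_one.trans ht.le)
    · rw [hg, Set.indicator_of_notMem ht, norm_zero]
      positivity
  have hgl : MeasureTheory.LocallyIntegrableOn g (Set.Ioi 0) := by
    refine (MeasureTheory.LocallyIntegrable.mono (f := fun _ : ℝ => M + ‖κ‖)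
      (MeasureTheory.locallyIntegrable_const _) hgm.aestronglyMeasurable
      (.of_forall fun t => (hgb t).trans (le_abs_self _))).locallyIntegrableOn _
  have hmel : ∀ s : ℂ, mellin g (-s) = ∫ t in Set.Ioi (1 : ℝ), E t * (t : ℂ) ^ (-(s + 1)) := by
    intro s
    rw [mellin, ← MeasureTheory.integral_indicator measurableSet_Ioi,
      ← MeasureTheory.integral_indicator measurableSet_Ioi]
    refine MeasureTheory.integral_congr_ae (.of_forall fun t => ?_)
    simp only [hg, Set.indicator, Set.mem_Ioi, smul_eq_mul]
    by_cases h1 : 1 < t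
    · rw [if_pos h1, if_pos h1, if_pos (by linarith), mul_comm, neg_add']
    · simp [h1]
  have hcpow : ∀ {s : ℂ} {t : ℝ}, t ∈ Set.Ioi (1 : ℝ) →
      ‖(t : ℂ) ^ (-(s + 1))‖ = t ^ (-(s.re + 1)) := by
    intro s t ht
    rw [Complex.norm_cpow_eq_rpow_re_of_pos (zero_lt_one.trans ht)]
    simp
  have hint : ∀ s : ℂ, 0 < s.re →
      MeasureTheory.IntegrableOn (fun t : ℝ => (M + ‖κ‖) * t ^ (-(s.re + 1))) (Set.Ioi 1) :=
    fun s hs => (integrableOn_Ioi_rpow_of_lt (by linarith) one_pos).const_mul _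
  have hbd : ∀ s : ℂ, ∀ᵐ t ∂(MeasureTheory.volume.restrict (Set.Ioi (1 : ℝ))),
      ‖E t * (t : ℂ) ^ (-(s + 1))‖ ≤ (M + ‖κ‖) * t ^ (-(s.re + 1)) := by
    intro s
    filter_upwards [MeasureTheory.ae_restrict_mem measurableSet_Ioi] with t ht
    rw [norm_mul, hcpow ht]
    have := zero_lt_one.trans ht.out
    gcongr
    exact hEb t this.le
  refine ⟨fun s => s * mellin g (-s), ?_, fun s hs => ?_, fun s hs hS => ?_⟩
  · intro s hs
    have h0 : 0 < s.re := hs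
    refine (differentiableAt_id.mul (DifferentiableAt.fun_comp' (g := mellin g) s ?_
      differentiableAt_id.fun_neg)).differentiableWithinAt
    refine mellin_differentiableAt_of_isBigO_rpow (a := 0) (b := -s.re - 1) hgl ?_ (by simpa) ?_
      (by simp)
    · refine Asymptotics.IsBigO.of_bound (M + ‖κ‖) (.of_forall fun t => ?_)
      simpa using hgb t
    · refine Asymptotics.IsBigO.of_bound 0 ?_
      have : Set.Iio (1 : ℝ) ∈ nhdsWithin (0 : ℝ) (Set.Ioi 0) :=
        mem_nhdsWithin_of_mem_nhds (Iio_mem_nhds one_pos)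
      filter_upwards [this] with t ht
      rw [hg, Set.indicator_of_notMem (by simpa using le_of_lt ht)]
      simp
  · rw [norm_mul, hmel]
    gcongr
    refine (MeasureTheory.norm_integral_le_of_norm_le (hint s hs) (hbd s)).trans_eq ?_
    rw [MeasureTheory.integral_const_mul, integral_Ioi_rpow_of_lt (by linarith) one_pos]
    simp
    field_simp
  · have h0 : 0 < s.re := by linarith
    have hs1 : s - 1 ≠ 0 := sub_ne_zero.mpr fun h => by simp [h] at hs
    have hO : (fun n : ℕ => ∑ k ∈ Finset.Icc 1 n, f k) =O[Filter.atTop]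
        fun n => (n : ℝ) ^ (1 : ℝ) := by
      refine Asymptotics.IsBigO.of_bound (M + ‖κ‖) ?_
      filter_upwards [Filter.eventually_ge_atTop 1] with n hn
      have hn' : (1 : ℝ) ≤ n := by exact_mod_cast hn
      have h1 := norm_add_le (∑ k ∈ Finset.Icc 1 n, f k - κ * n) (κ * n)
      rw [sub_add_cancel, norm_mul, Complex.norm_natCast] at h1
      rw [Real.rpow_one, Real.norm_natCast]
      nlinarith [hf n, norm_nonneg κ]
    have hE1 : MeasureTheory.IntegrableOn (fun t : ℝ => E t * (t : ℂ) ^ (-(s + 1)))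
        (Set.Ioi 1) := by
      refine (hint s h0).mono' ?_ (hbd s)
      exact (hEm.mul (by fun_prop)).aestronglyMeasurable
    have hE2 : MeasureTheory.IntegrableOn (fun t : ℝ => κ * (t : ℂ) ^ (-s)) (Set.Ioi 1) :=
      (integrableOn_Ioi_cpow_of_lt (by simpa using hs) one_pos).const_mul κ
    beta_reduce
    rw [LSeries_eq_mul_integral f zero_le_one hs hS hO, hmel]
    have hsplit : ∫ t in Set.Ioi (1 : ℝ), (∑ k ∈ Finset.Icc 1 ⌊t⌋₊, f k) * (t : ℂ) ^ (-(s + 1)) =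
        ∫ t in Set.Ioi (1 : ℝ), (κ * (t : ℂ) ^ (-s) + E t * (t : ℂ) ^ (-(s + 1))) := by
      refine MeasureTheory.setIntegral_congr_fun measurableSet_Ioi fun t ht => ?_
      have ht0 : (t : ℂ) ≠ 0 := by exact_mod_cast (zero_lt_one.trans ht.out).ne'
      have e : (t : ℂ) ^ (-s) = t * (t : ℂ) ^ (-(s + 1)) := by
        rw [show -s = 1 + -(s + 1) by ring, Complex.cpow_add _ _ ht0, Complex.cpow_one]
      simp only [hE]
      rw [e]
      ring
    rw [hsplit, MeasureTheory.integral_add hE2 hE1, MeasureTheory.integral_const_mul,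
      integral_Ioi_cpow_of_lt (by simpa using hs) one_pos]
    have hs2 : -s + 1 ≠ 0 := fun h => hs1 (by linear_combination -h)
    simp only [ofReal_one, Complex.one_cpow]
    field_simp
    ring

theorem norm_LSeries_le_of_re_eq {f : ℕ → ℂ} {s t : ℂ} (h : s.re = t.re)
    (ht : LSeriesSummable f t) : ‖LSeries f s‖ ≤ ∑' n, ‖LSeries.term f t n‖ := by
  have e : ∀ n, ‖LSeries.term f s n‖ = ‖LSeries.term f t n‖ := fun n => by
    rw [LSeries.norm_term_eq, LSeries.norm_term_eq, h]
  exact tsum_of_norm_bounded ht.norm.hasSum fun n => (e n).le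

/-- The partial sums of a nontrivial Dirichlet character are bounded. -/
theorem DirichletCharacter.norm_sum_Icc_le {q : ℕ} [NeZero q] {χ : DirichletCharacter ℂ q}
    (hχ : χ ≠ 1) (n : ℕ) : ‖∑ k ∈ Finset.Icc 1 n, χ (k : ZMod q)‖ ≤ q + 1 := by
  set T : ℕ → ℂ := fun m => ∑ k ∈ Finset.range m, χ (k : ZMod q) with hT
  have hTb : ∀ m, ‖T m‖ ≤ m := fun m =>
    (norm_sum_le_of_le _ fun k _ => χ.norm_le_one _).trans_eq (by simp)
  have hTq : T q = 0 := by
    rw [← MulChar.sum_eq_zero_of_ne_one hχ]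
    refine Finset.sum_bij' (fun k _ => (k : ZMod q)) (fun a _ => a.val) (by simp)
      (fun a _ => by simpa using ZMod.val_lt a)
      (fun k hk => ZMod.val_cast_of_lt (Finset.mem_range.mp hk)) (by simp) (by simp)
  have hper : Function.Periodic T q := by
    intro m
    simp only [hT]
    rw [add_comm m q, Finset.sum_range_add]
    change T q + _ = _
    rw [hTq, zero_add]
    simp
  have h1 : ∑ k ∈ Finset.Icc 1 n, χ (k : ZMod q) = T (n + 1) - χ ((0 : ℕ) : ZMod q) := by
    simp only [hT]
    rw [eq_sub_iff_add_eq, add_comm, Finset.range_eq_Ico,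
      Finset.sum_eq_sum_Ico_succ_bot (Nat.succ_pos n)]
    rfl
  have h2 : ‖T (n + 1)‖ ≤ q := by
    rw [← hper.map_mod_nat]
    exact (hTb _).trans (by exact_mod_cast (Nat.mod_lt _ (NeZero.pos q)).le)
  rw [h1]
  exact (norm_sub_le _ _).trans (add_le_add h2 (χ.norm_le_one _))

/-- The bound for the twisted Möbius sums, given a multiplier `P` which removes the possible pole of
the `L`-function without creating growth. -/
theorem DirichletCharacter.exists_norm_sum_mul_moebius_le {q : ℕ} [NeZero q]
    (χ : DirichletCharacter ℂ q) {G P : ℂ → ℂ} {K c D : ℝ}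
    (hG : DifferentiableOn ℂ G {s | 1 / 2 < s.re}) (hG0 : ∀ s : ℂ, 1 / 2 < s.re → G s ≠ 0)
    (hK : 0 < K) (hb : ∀ s : ℂ, 1 / 2 < s.re → s.re < 4 → ‖G s‖ ≤ K * (3 + |s.im|))
    (hP : DifferentiableOn ℂ P {s | 1 / 2 < s.re}) (hP1 : ∀ s : ℂ, 1 / 2 < s.re → ‖P s‖ ≤ 1)
    (hGP : ∀ s : ℂ, 1 < s.re → G s = P s * LFunction χ s)
    (hc : 0 < c) (hPc : ∀ s : ℂ, s.re = 2 → c ≤ ‖P s‖)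
    (hPD : ∀ s : ℂ, s.re = 2 → ‖deriv P s / P s‖ ≤ D) {ε : ℝ} (hε : 0 < ε) :
    ∃ C > (0 : ℝ), ∀ x : ℝ, 1 ≤ x →
      ‖∑ n ∈ Finset.Icc 1 ⌊x⌋₊, χ (n : ZMod q) * (ArithmeticFunction.moebius n : ℂ)‖ ≤
        C * x ^ (1 / 2 + ε) := by
  have hopen : IsOpen {s : ℂ | 1 / 2 < s.re} := isOpen_lt continuous_const continuous_re
  set a : ℕ → ℂ := fun n => χ (n : ZMod q) * (ArithmeticFunction.moebius n : ℂ) with ha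
  have ha1 : ∀ n, ‖a n‖ ≤ 1 := by
    intro n
    have h2 : ‖(ArithmeticFunction.moebius n : ℂ)‖ ≤ 1 := by
      rw [Complex.norm_intCast]
      exact_mod_cast ArithmeticFunction.abs_moebius_le_one
    rw [ha, norm_mul]
    exact mul_le_one₀ (χ.norm_le_one _) (norm_nonneg _) h2
  have hLa : ∀ s : ℂ, 1 < s.re → LFunction χ s * LSeries a s = 1 := by
    intro s hs
    rw [χ.LFunction_eq_LSeries hs]
    exact LSeries.mul_mu_eq_one χ hs
  have hL0 : ∀ s : ℂ, 1 < s.re → LFunction χ s ≠ 0 := fun s hs =>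
    left_ne_zero_of_mul_eq_one (hLa s hs)
  have h2 : (1 : ℝ) < (2 : ℂ).re := by norm_num
  have hsa : LSeriesSummable a 2 :=
    LSeriesSummable_mul χ (ArithmeticFunction.LSeriesSummable_moebius_iff.mpr h2)
  obtain ⟨S, hS, hSb⟩ : ∃ S > 0, ∀ s : ℂ, s.re = 2 → ‖LSeries a s‖ ≤ S :=
    ⟨∑' n, ‖LSeries.term a 2 n‖ + 1, by positivity, fun s hs =>
      (norm_LSeries_le_of_re_eq (by simpa using hs) hsa).trans (by linarith)⟩
  obtain ⟨V, hV, hVb⟩ : ∃ V > 0, ∀ s : ℂ, s.re = 2 →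
      ‖deriv (LFunction χ) s / LFunction χ s‖ ≤ V := by
    refine ⟨∑' n, ‖LSeries.term ((fun n : ℕ => χ (n : ZMod q)) *
      (fun n => (ArithmeticFunction.vonMangoldt n : ℂ))) 2 n‖ + 1, by positivity, fun s hs => ?_⟩
    have h1 : 1 < s.re := by linarith
    have e := LSeries_twist_vonMangoldt_eq χ h1
    rw [χ.deriv_LFunction_eq_deriv_LSeries h1, χ.LFunction_eq_LSeries h1, ← norm_neg, ← neg_div,
      ← e]
    exact (norm_LSeries_le_of_re_eq (by simpa using hs)
      (LSeriesSummable_twist_vonMangoldt χ h2)).trans (by linarith)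
  have hlow : ∀ s : ℂ, s.re = 2 → c / S ≤ ‖G s‖ := by
    intro s hs
    have h1 : 1 < s.re := by linarith
    have e : ‖LFunction χ s‖ * ‖LSeries a s‖ = 1 := by rw [← norm_mul, hLa s h1, norm_one]
    have h3 : 1 ≤ ‖LFunction χ s‖ * S := by
      rw [← e]
      gcongr
      exact hSb s hs
    rw [hGP s h1, norm_mul, div_le_iff₀ hS, mul_assoc]
    calc c = c * 1 := (mul_one c).symm
      _ ≤ ‖P s‖ * (‖LFunction χ s‖ * S) := by
          gcongr
          exact hPc s hs
  have hDG : ∀ s : ℂ, s.re = 2 → ‖deriv G s / G s‖ ≤ |D| + V := by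
    intro s hs
    have h1 : 1 < s.re := by linarith
    have hP0 : P s ≠ 0 := norm_pos_iff.mp (hc.trans_le (hPc s hs))
    have hPs : DifferentiableAt ℂ P s :=
      hP.differentiableAt (hopen.mem_nhds (by simp only [Set.mem_ofPred_eq]; linarith))
    have hLs : DifferentiableAt ℂ (LFunction χ) s :=
      χ.differentiableAt_LFunction s (.inl fun h => by norm_num [h] at hs)
    have hev : G =ᶠ[nhds s] fun z => P z * LFunction χ z := by
      filter_upwards [(isOpen_lt continuous_const continuous_re).mem_nhds h1] with z hz
      exact hGP z hz
    have hd : deriv G s = deriv P s * LFunction χ s + P s * deriv (LFunction χ) s := by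
      rw [hev.deriv_eq, deriv_fun_mul hPs hLs]
    have e : deriv G s / G s = deriv P s / P s + deriv (LFunction χ) s / LFunction χ s := by
      have := hL0 s h1
      rw [hd, hGP s h1]
      field_simp
    rw [e]
    exact (norm_add_le _ _).trans (add_le_add ((hPD s hs).trans (le_abs_self D)) (hVb s hs))
  refine exists_norm_sum_le_rpow ha1 (A := fun s => P s / G s) (hP.div hG hG0) (fun s hs => ?_)
    (fun δ η hδ hδ1 hη => ?_) hε
  · have h1 : 1 < s.re := by linarith
    have hP0 : P s ≠ 0 := norm_pos_iff.mp (hc.trans_le (hPc s hs))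
    have hL := hL0 s h1
    rw [hGP s h1, div_eq_iff (mul_ne_zero hP0 hL)]
    linear_combination -(P s) * hLa s h1
  · obtain ⟨B, hB, h⟩ := exists_norm_inv_le_rpow (k := 1) hG hG0 hK (by simpa using hb)
      (div_pos hc hS) hlow (by positivity) hDG hδ hδ1 hη
    refine ⟨B, hB, fun s hs1 hs2 => ?_⟩
    rw [div_eq_mul_inv, norm_mul]
    exact (mul_le_of_le_one_left (norm_nonneg _) (hP1 s (by linarith))).trans (h s hs1 hs2)

theorem norm_sub_one_div_add_one_le {s : ℂ} (hs : 0 ≤ s.re) : ‖(s - 1) / (s + 1)‖ ≤ 1 := by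
  have h1 : s + 1 ≠ 0 := ne_zero_of_re_pos (by simp; linarith)
  rw [norm_div, div_le_one (norm_pos_iff.mpr h1), ← sq_le_sq₀ (norm_nonneg _) (norm_nonneg _),
    Complex.sq_norm, Complex.sq_norm, Complex.normSq_apply, Complex.normSq_apply]
  simp only [sub_re, sub_im, add_re, add_im, one_re, one_im]
  nlinarith

theorem eqOn_of_eqOn_one_lt_re {F H : ℂ → ℂ} (hF : DifferentiableOn ℂ F {s | 0 < s.re})
    (hH : DifferentiableOn ℂ H {s | 0 < s.re}) (h : ∀ s : ℂ, 1 < s.re → F s = H s) {s : ℂ}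
    (hs : 0 < s.re) : F s = H s := by
  have hopen : IsOpen {s : ℂ | 0 < s.re} := isOpen_lt continuous_const continuous_re
  have hev : F =ᶠ[nhds 2] H := by
    filter_upwards [(isOpen_lt continuous_const continuous_re).mem_nhds
      (show (1 : ℝ) < (2 : ℂ).re by norm_num)] with z hz
    exact h z hz
  exact (hF.analyticOnNhd hopen).eqOn_of_preconnected_of_eventuallyEq (hH.analyticOnNhd hopen)
    (convex_halfSpace_re_gt 0).isPreconnected (show (0 : ℝ) < (2 : ℂ).re by norm_num) hev hs

theorem norm_le_of_re_lt_four {s : ℂ} (h0 : 0 < s.re) (h4 : s.re < 4) :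
    ‖s‖ ≤ 2 * (3 + |s.im|) := by
  have h := Complex.norm_le_abs_re_add_abs_im s
  rw [abs_of_pos h0] at h
  linarith [abs_nonneg s.im]

theorem DirichletCharacter.exists_norm_LFunction_le {q : ℕ} [NeZero q]
    {χ : DirichletCharacter ℂ q} (hχ : χ ≠ 1) :
    ∃ K > 0, ∀ s : ℂ, 1 / 2 < s.re → s.re < 4 → ‖LFunction χ s‖ ≤ K * (3 + |s.im|) := by
  obtain ⟨F, hF, hFb, hFL⟩ := exists_LSeries_eq_add (f := fun n : ℕ => χ (n : ZMod q)) (κ := 0)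
    (M := q + 1) (fun n => by simpa using norm_sum_Icc_le hχ n)
  refine ⟨4 * (q + 1), by positivity, fun s hs hs4 => ?_⟩
  have e : LFunction χ s = F s := by
    refine eqOn_of_eqOn_one_lt_re (differentiable_LFunction hχ).differentiableOn hF
      (fun z hz => ?_) (by linarith)
    rw [χ.LFunction_eq_LSeries hz, hFL z hz (LSeriesSummable_of_one_lt_re χ hz)]
    simp
  rw [e]
  have h0 : 0 < s.re := by linarith
  calc ‖F s‖ ≤ ‖s‖ * ((q + 1 + ‖(0 : ℂ)‖) / s.re) := hFb s h0
    _ ≤ (2 * (3 + |s.im|)) * ((q + 1) / (1 / 2)) := by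
        rw [norm_zero, add_zero]
        gcongr
        exact norm_le_of_re_lt_four h0 hs4
    _ = _ := by ring

theorem DirichletCharacter.exists_norm_LFunctionTrivChar₁_le :
    ∃ K > 0, ∀ s : ℂ, 1 / 2 < s.re → s.re < 4 →
      ‖LFunctionTrivChar₁ 1 s / (s + 1)‖ ≤ K * (3 + |s.im|) := by
  obtain ⟨F, hF, hFb, hFL⟩ := exists_LSeries_eq_add
    (f := fun n : ℕ => (1 : DirichletCharacter ℂ 1) (n : ZMod 1)) (κ := 1) (M := 0)
    (fun n => by
      have h : ∀ k : ℕ, (1 : DirichletCharacter ℂ 1) (k : ZMod 1) = 1 := fun k =>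
        MulChar.one_apply (isUnit_of_subsingleton _)
      simp [h])
  refine ⟨5, by norm_num, fun s hs hs4 => ?_⟩
  have h0 : 0 < s.re := by linarith
  have e : LFunctionTrivChar₁ 1 s = s + (s - 1) * F s := by
    refine eqOn_of_eqOn_one_lt_re (H := fun s => s + (s - 1) * F s)
      (differentiable_LFunctionTrivChar₁ 1).differentiableOn (by fun_prop) (fun z hz => ?_) h0
    have hz1 : z ≠ 1 := fun h => by simp [h] at hz
    have hz2 : z - 1 ≠ 0 := sub_ne_zero.mpr hz1
    rw [LFunctionTrivChar₁, Function.update_of_ne hz1, LFunctionTrivChar,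
      LFunction_eq_LSeries _ hz, hFL z hz (LSeriesSummable_of_one_lt_re _ hz)]
    field_simp
  have hs1 : s + 1 ≠ 0 := ne_zero_of_re_pos (by simp; linarith)
  have e2 : LFunctionTrivChar₁ 1 s / (s + 1) = s / (s + 1) + (s - 1) / (s + 1) * F s := by
    rw [e]; field_simp
  have h1 : ‖s / (s + 1)‖ ≤ 1 := by
    have := norm_sub_one_div_add_one_le h0.le
    have e3 : s / (s + 1) = ((s - 1) / (s + 1) + 1) / 2 := by field_simp; ring
    rw [e3, norm_div]
    have := norm_add_le ((s - 1) / (s + 1)) 1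
    rw [norm_one] at this
    rw [Complex.norm_ofNat, div_le_one two_pos]
    linarith
  have h2 : ‖F s‖ ≤ 4 * (3 + |s.im|) := by
    calc ‖F s‖ ≤ ‖s‖ * ((0 + ‖(1 : ℂ)‖) / s.re) := hFb s h0
      _ ≤ (2 * (3 + |s.im|)) * (1 / (1 / 2)) := by
          rw [norm_one, zero_add]
          gcongr
          exact norm_le_of_re_lt_four h0 hs4
      _ = _ := by ring
  rw [e2]
  refine (norm_add_le _ _).trans ?_
  rw [norm_mul]
  have h3 := mul_le_of_le_one_left (norm_nonneg (F s)) (norm_sub_one_div_add_one_le h0.le)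
  linarith [abs_nonneg s.im]

theorem GRH_implies_summatory_bound {q : ℕ} [NeZero q] (hq : 0 < q)
    (χ : DirichletCharacter ℂ q) (hχ : χ.IsPrimitive)
    (hGRH : ∀ ρ : ℂ, DirichletCharacter.LFunction χ ρ = 0 → 0 < ρ.re → ρ.re < 1 →
      ρ.re = 1 / 2) :
    ∀ ε > (0 : ℝ), ∃ C > (0 : ℝ), ∀ x : ℝ, 1 ≤ x →
      ‖(∑ n ∈ Finset.Icc 1 ⌊x⌋₊,
        χ (n : ZMod q) * (ArithmeticFunction.moebius n : ℂ))‖ ≤ C * x ^ (1 / 2 + ε) := by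
  intro ε hε
  have hL0 : ∀ s : ℂ, 1 / 2 < s.re → (χ ≠ 1 ∨ s ≠ 1) → DirichletCharacter.LFunction χ s ≠ 0 := by
    intro s hs h1 h0
    rcases lt_or_ge s.re 1 with h | h
    · exact hs.ne' (hGRH s h0 (by linarith) h)
    · exact DirichletCharacter.LFunction_ne_zero_of_one_le_re χ h1 h h0
  by_cases h1 : χ = 1
  · subst h1
    obtain rfl : q = 1 := by
      rw [DirichletCharacter.isPrimitive_def, DirichletCharacter.conductor_one] at hχ
      exact hχ.symm
    obtain ⟨K, hK, hb⟩ := DirichletCharacter.exists_norm_LFunctionTrivChar₁_le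
    have hs1 : ∀ s : ℂ, 1 / 2 < s.re → s + 1 ≠ 0 := fun s hs =>
      ne_zero_of_re_pos (by simp; linarith)
    refine DirichletCharacter.exists_norm_sum_mul_moebius_le 1
      (G := fun s => DirichletCharacter.LFunctionTrivChar₁ 1 s / (s + 1))
      (P := fun s => (s - 1) / (s + 1)) (c := 1 / 3) (D := 2)
      ((DirichletCharacter.differentiable_LFunctionTrivChar₁ 1).differentiableOn.div
        (by fun_prop) hs1)
      (fun s hs => div_ne_zero ?_ (hs1 s hs)) hK hb
      (DifferentiableOn.div (by fun_prop) (by fun_prop) hs1)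
      (fun s hs => norm_sub_one_div_add_one_le (by linarith)) (fun s hs => ?_) (by norm_num)
      (fun s hs => ?_) (fun s hs => ?_) hε
    · rcases eq_or_ne s 1 with rfl | h
      · exact DirichletCharacter.LFunctionTrivChar₁_apply_one_ne_zero 1
      · rw [DirichletCharacter.LFunctionTrivChar₁, Function.update_of_ne h]
        exact mul_ne_zero (sub_ne_zero.mpr h) (hL0 s hs (.inr h))
    · have h : s ≠ 1 := fun h => by simp [h] at hs
      simp only [DirichletCharacter.LFunctionTrivChar₁]
      rw [Function.update_of_ne h]
      ring
    · have h := hs1 s (by linarith)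
      have hre : 1 ≤ ‖s - 1‖ := by
        refine le_trans ?_ ((le_abs_self _).trans (Complex.abs_re_le_norm (s - 1)))
        simp [hs]
        norm_num
      have h3 : ‖s + 1‖ ≤ ‖s - 1‖ + 2 := by
        have := norm_add_le (s - 1) 2
        rwa [show s - 1 + 2 = s + 1 by ring, Complex.norm_ofNat] at this
      rw [norm_div, le_div_iff₀ (norm_pos_iff.mpr h)]
      linarith
    · have h := hs1 s (by linarith)
      have hm : s - 1 ≠ 0 := sub_ne_zero.mpr fun h => by norm_num [h] at hs
      have hd : HasDerivAt (fun s : ℂ => (s - 1) / (s + 1))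
          ((1 * (s + 1) - (s - 1) * 1) / (s + 1) ^ 2) s :=
        ((hasDerivAt_id s).sub_const 1).div ((hasDerivAt_id s).add_const 1) h
      have e : deriv (fun s : ℂ => (s - 1) / (s + 1)) s / ((s - 1) / (s + 1)) =
          2 / ((s - 1) * (s + 1)) := by
        rw [hd.deriv]; field_simp; ring
      have hre : 1 ≤ ‖s - 1‖ := by
        refine le_trans ?_ ((le_abs_self _).trans (Complex.abs_re_le_norm (s - 1)))
        simp [hs]
        norm_num
      have hre' : 1 ≤ ‖s + 1‖ := by
        refine le_trans ?_ ((le_abs_self _).trans (Complex.abs_re_le_norm (s + 1)))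
        simp [hs]
      rw [e, norm_div, norm_mul, Complex.norm_ofNat]
      exact div_le_self (by norm_num) (one_le_mul_of_one_le_of_one_le hre hre')
  · obtain ⟨K, hK, hb⟩ := DirichletCharacter.exists_norm_LFunction_le h1
    exact DirichletCharacter.exists_norm_sum_mul_moebius_le χ (P := fun _ => 1) (c := 1) (D := 0)
      (DirichletCharacter.differentiable_LFunction h1).differentiableOn
      (fun s hs => hL0 s hs (.inl h1)) hK hb (differentiableOn_const 1) (by simp) (by simp)
      one_pos (by simp) (by simp) hε
end

section
/- Let q be a positive integer, let χ be a primitive Dirichlet character modulo q, let k ≥ 1 be a real number, let c ∈ (−1, 0) and d ∈ ((k+1)/2, k/2 + 1) be real numbers, let x > 0, and let A₁ ∈ (0, π/4). Then there exists C > 0 (depending only on q, k, c, d, x, A₁) such that for every real T ≥ 2 satisfying 1/|L(k − 2σ − 2iT, χ)| ≤ e^{2A₁·T} for all σ ∈ [c, d], one has |∫_c^d Γ(σ + iT)·(πx²/q)^{−(σ+iT)}/L(k − 2(σ + iT), χ) dσ| ≤ C·T^{d − 1/2}·e^{(2A₁ − π/2)·T}. -/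
open Complex

/-- The partial products of `|Γ(σ + iT)|⁻²` and `|Γ(iT)|⁻²` compare up to a bounded factor. -/
lemma prod_sq_add_sq_mul_rpow_le {σ T : ℝ} (h0 : 0 ≤ σ) (h1 : σ ≤ 1) (hT : 2 ≤ T) (N : ℕ) :
    (∏ j ∈ Finset.range N, ((j : ℝ) ^ 2 + T ^ 2)) * (((N : ℝ) ^ 2 + T ^ 2) / T ^ 2) ^ σ ≤
      Real.exp (∑ j ∈ Finset.range N, 1 / ((j : ℝ) + 1) ^ 2) *
        ∏ j ∈ Finset.range N, (((j : ℝ) + σ) ^ 2 + T ^ 2) := by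
  have hT0 : 0 < T := by linarith
  induction N with
  | zero => simp [hT0.ne']
  | succ n ih =>
    rw [Finset.prod_range_succ, Finset.prod_range_succ, Finset.sum_range_succ, Real.exp_add]
    have hn : (0 : ℝ) ≤ n := n.cast_nonneg
    have hu : 0 < (n : ℝ) ^ 2 + T ^ 2 := by positivity
    have hv : 0 < ((n : ℝ) + σ) ^ 2 + T ^ 2 := by positivity
    have hsplit : ((((n + 1 : ℕ) : ℝ) ^ 2 + T ^ 2) / T ^ 2) ^ σ =
        (((n : ℝ) ^ 2 + T ^ 2) / T ^ 2) ^ σ *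
          (1 + (2 * n + 1) / ((n : ℝ) ^ 2 + T ^ 2)) ^ σ := by
      rw [← Real.mul_rpow (by positivity) (by positivity)]
      congr 1
      push_cast
      field_simp
      ring
    have hbern : (1 + (2 * n + 1) / ((n : ℝ) ^ 2 + T ^ 2)) ^ σ ≤
        1 + σ * ((2 * n + 1) / ((n : ℝ) ^ 2 + T ^ 2)) :=
      rpow_one_add_le_one_add_mul_self
        (by linarith [show 0 ≤ (2 * n + 1) / ((n : ℝ) ^ 2 + T ^ 2) by positivity]) h0 h1
    have hstep : ((n : ℝ) ^ 2 + T ^ 2) * (1 + (2 * n + 1) / ((n : ℝ) ^ 2 + T ^ 2)) ^ σ ≤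
        Real.exp (1 / ((n : ℝ) + 1) ^ 2) * (((n : ℝ) + σ) ^ 2 + T ^ 2) := by
      calc _ ≤ ((n : ℝ) ^ 2 + T ^ 2) * (1 + σ * ((2 * n + 1) / ((n : ℝ) ^ 2 + T ^ 2))) := by
            gcongr
        _ = ((n : ℝ) + σ) ^ 2 + T ^ 2 + σ * (1 - σ) := by
            field_simp
            ring
        _ ≤ (1 / ((n : ℝ) + 1) ^ 2 + 1) * (((n : ℝ) + σ) ^ 2 + T ^ 2) := by
            have : σ * (1 - σ) ≤ 1 / ((n : ℝ) + 1) ^ 2 * (((n : ℝ) + σ) ^ 2 + T ^ 2) := by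
              rw [one_div_mul_eq_div, le_div_iff₀ (by positivity)]
              have h4 : σ * (1 - σ) ≤ 1 / 4 := by nlinarith [sq_nonneg (σ - 1 / 2)]
              have : σ * (1 - σ) * ((n : ℝ) + 1) ^ 2 ≤ 1 / 4 * ((n : ℝ) + 1) ^ 2 := by gcongr
              nlinarith [sq_nonneg ((n : ℝ) - 1), mul_nonneg hn h0]
            linarith
        _ ≤ _ := by
            gcongr
            exact Real.add_one_le_exp _
    calc _ = ((∏ j ∈ Finset.range n, ((j : ℝ) ^ 2 + T ^ 2)) *
          (((n : ℝ) ^ 2 + T ^ 2) / T ^ 2) ^ σ) *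
          (((n : ℝ) ^ 2 + T ^ 2) * (1 + (2 * n + 1) / ((n : ℝ) ^ 2 + T ^ 2)) ^ σ) := by
          rw [hsplit]; ring
      _ ≤ _ := mul_le_mul ih hstep (by positivity) (by positivity)
      _ = _ := by ring

lemma norm_GammaSeq_sq {σ T : ℝ} {n : ℕ} (hn : 0 < n) :
    ‖GammaSeq ((σ : ℂ) + T * I) n‖ ^ 2 =
      ((n : ℝ) ^ σ) ^ 2 * (n.factorial : ℝ) ^ 2 /
        ∏ j ∈ Finset.range (n + 1), (((j : ℝ) + σ) ^ 2 + T ^ 2) := by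
  have hterm (j : ℕ) : ‖(σ : ℂ) + T * I + j‖ ^ 2 = ((j : ℝ) + σ) ^ 2 + T ^ 2 := by
    rw [← normSq_eq_norm_sq, normSq_apply]
    simp
    ring
  rw [GammaSeq, norm_div, norm_mul, norm_prod, div_pow, mul_pow, ← Finset.prod_pow,
    norm_natCast_cpow_of_pos hn]
  simp [hterm]

/-- On the strip `0 ≤ σ ≤ 1`, moving from `iT` to `σ + iT` costs at most a factor `T ^ σ`. -/
lemma exists_norm_Gamma_le_rpow_mul_norm_Gamma_mul_I :
    ∃ C > (0 : ℝ), ∀ σ T : ℝ, 0 ≤ σ → σ ≤ 1 → 2 ≤ T →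
      ‖Gamma ((σ : ℂ) + T * I)‖ ^ 2 ≤ C * (T ^ σ) ^ 2 * ‖Gamma (T * I)‖ ^ 2 := by
  have hsum : Summable fun j : ℕ ↦ 1 / ((j : ℝ) + 1) ^ 2 := by
    have := (summable_nat_add_iff 1).2 (Real.summable_one_div_nat_pow.2 one_lt_two)
    exact_mod_cast this
  refine ⟨Real.exp (∑' j : ℕ, 1 / ((j : ℝ) + 1) ^ 2), Real.exp_pos _, fun σ T h0 h1 hT ↦ ?_⟩
  have hT0 : 0 < T := by linarith
  have hlim := ((GammaSeq_tendsto_Gamma ((σ : ℂ) + T * I)).norm).pow 2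
  have hlim0 := (((GammaSeq_tendsto_Gamma (T * I)).norm).pow 2).const_mul
    (Real.exp (∑' j : ℕ, 1 / ((j : ℝ) + 1) ^ 2) * (T ^ σ) ^ 2)
  refine le_of_tendsto_of_tendsto hlim hlim0 ?_
  filter_upwards [Filter.eventually_gt_atTop 0] with n hn
  have hz := norm_GammaSeq_sq (σ := 0) (T := T) hn
  simp only [ofReal_zero, zero_add, Real.rpow_zero, one_pow, one_mul, add_zero] at hz
  rw [hz, norm_GammaSeq_sq hn]
  have hprod := (prod_sq_add_sq_mul_rpow_le h0 h1 hT (n + 1)).trans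
    (mul_le_mul_of_nonneg_right
      (Real.exp_le_exp.2 (hsum.sum_le_tsum (Finset.range (n + 1)) fun _ _ ↦ by positivity))
      (by positivity))
  have hn0 : (0 : ℝ) < n := by exact_mod_cast hn
  have hpow : ((n : ℝ) ^ σ) ^ 2 ≤
      (T ^ σ) ^ 2 * ((((n + 1 : ℕ) : ℝ) ^ 2 + T ^ 2) / T ^ 2) ^ σ := by
    rw [← Real.rpow_natCast, ← Real.rpow_natCast, ← Real.rpow_mul hn0.le, ← Real.rpow_mul hT0.le,
      mul_comm σ, Real.rpow_mul hn0.le, Real.rpow_mul hT0.le,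
      ← Real.mul_rpow (by positivity) (by positivity)]
    refine Real.rpow_le_rpow (by positivity) ?_ h0
    push_cast
    rw [Real.rpow_two, Real.rpow_two, mul_div_cancel₀ _ (by positivity)]
    nlinarith
  set P := ∏ j ∈ Finset.range (n + 1), ((j : ℝ) ^ 2 + T ^ 2) with hP
  set Q := ∏ j ∈ Finset.range (n + 1), (((j : ℝ) + σ) ^ 2 + T ^ 2) with hQ
  have hP0 : 0 < P := Finset.prod_pos fun _ _ ↦ by positivity
  have hQ0 : 0 < Q := Finset.prod_pos fun _ _ ↦ by positivity
  rw [← mul_div_assoc, div_le_div_iff₀ hQ0 hP0]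
  calc _ ≤ ((T ^ σ) ^ 2 * ((((n + 1 : ℕ) : ℝ) ^ 2 + T ^ 2) / T ^ 2) ^ σ) *
        (n.factorial : ℝ) ^ 2 * P := by gcongr
    _ = (T ^ σ) ^ 2 * (n.factorial : ℝ) ^ 2 *
        (P * ((((n + 1 : ℕ) : ℝ) ^ 2 + T ^ 2) / T ^ 2) ^ σ) := by ring
    _ ≤ (T ^ σ) ^ 2 * (n.factorial : ℝ) ^ 2 * _ :=
        mul_le_mul_of_nonneg_left hprod (by positivity)
    _ = _ := by ring

lemma norm_Gamma_mul_I_sq {T : ℝ} (hT : 0 < T) :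
    ‖Gamma (T * I)‖ ^ 2 = Real.pi / (T * Real.sinh (Real.pi * T)) := by
  have hTI : (T * I : ℂ) ≠ 0 := mul_ne_zero (by exact_mod_cast hT.ne') I_ne_zero
  have hrefl := congrArg norm (Gamma_mul_Gamma_one_sub (T * I))
  have hconj : ‖Gamma (-(T * I))‖ = ‖Gamma (T * I)‖ := by
    rw [← norm_conj (Gamma (T * I)), ← Gamma_conj]
    simp
  have hsin : ‖sin (Real.pi * (T * I))‖ = Real.sinh (Real.pi * T) := by
    rw [← mul_assoc, sin_mul_I, norm_mul, norm_I, mul_one, ← ofReal_mul, ← ofReal_sinh,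
      norm_real, Real.norm_of_nonneg (Real.sinh_nonneg_iff.2 (by positivity))]
  rw [show (1 - T * I : ℂ) = -(T * I) + 1 by ring, Gamma_add_one _ (neg_ne_zero.2 hTI), norm_mul,
    norm_mul, norm_neg, hconj, norm_div, hsin, norm_mul, norm_I, norm_real, norm_real,
    Real.norm_of_nonneg hT.le, Real.norm_of_nonneg Real.pi_pos.le, mul_one] at hrefl
  have hs : 0 < Real.sinh (Real.pi * T) := Real.sinh_pos_iff.2 (by positivity)
  rw [eq_div_iff hs.ne'] at hrefl
  rw [eq_div_iff (by positivity)]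
  linarith

lemma norm_Gamma_mul_I_sq_le {T : ℝ} (hT : 2 ≤ T) :
    ‖Gamma (T * I)‖ ^ 2 ≤ 4 * Real.pi * (T ^ (-1 / 2 : ℝ) * Real.exp (-(Real.pi / 2) * T)) ^ 2 := by
  have hT0 : 0 < T := by linarith
  have hT2 : (T ^ (-1 / 2 : ℝ)) ^ 2 = T⁻¹ := by
    rw [← Real.rpow_natCast, ← Real.rpow_mul hT0.le, ← Real.rpow_neg_one]
    norm_num
  have hexp : Real.exp (-(Real.pi / 2) * T) ^ 2 = (Real.exp (Real.pi * T))⁻¹ := by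
    rw [← Real.exp_nat_mul, ← Real.exp_neg]
    congr 1
    push_cast
    ring
  have hsinh : Real.exp (Real.pi * T) / 4 ≤ Real.sinh (Real.pi * T) := by
    rw [Real.sinh_eq]
    have h1 : Real.exp (-(Real.pi * T)) ≤ 1 := Real.exp_le_one_iff.2 (by
      have : 0 < Real.pi * T := by positivity
      linarith)
    have h2 := Real.add_one_le_exp (Real.pi * T)
    have h3 : 2 ≤ Real.pi * T := by nlinarith [Real.pi_gt_three]
    linarith
  rw [norm_Gamma_mul_I_sq hT0, mul_pow, hT2, hexp]
  calc _ ≤ Real.pi / (T * (Real.exp (Real.pi * T) / 4)) := by gcongr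
    _ = _ := by field_simp

/-- Upper bound in Stirling's formula for `Γ` on the vertical strip `-1 ≤ σ ≤ m + 1`. -/
lemma exists_norm_Gamma_le_of_mem_strip (m : ℕ) :
    ∃ C > (0 : ℝ), ∀ σ T : ℝ, -1 ≤ σ → σ ≤ m + 1 → 2 ≤ T →
      ‖Gamma ((σ : ℂ) + T * I)‖ ≤
        C * (T ^ (σ - 1 / 2) * Real.exp (-(Real.pi / 2) * T)) := by
  have hne {σ T : ℝ} (hT : 2 ≤ T) : (σ : ℂ) + T * I ≠ 0 := fun h ↦ by
    have := congrArg im h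
    simp at this
    linarith
  induction m with
  | zero =>
    obtain ⟨C, hC, hbound⟩ := exists_norm_Gamma_le_rpow_mul_norm_Gamma_mul_I
    have hunit (σ T : ℝ) (h0 : 0 ≤ σ) (h1 : σ ≤ 1) (hT : 2 ≤ T) : ‖Gamma ((σ : ℂ) + T * I)‖ ≤
        √(C * (4 * Real.pi)) * (T ^ (σ - 1 / 2) * Real.exp (-(Real.pi / 2) * T)) := by
      have hT0 : 0 < T := by linarith
      refine le_of_sq_le_sq ?_ (by positivity)
      rw [mul_pow, Real.sq_sqrt (by positivity), sub_eq_add_neg, Real.rpow_add hT0]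
      calc _ ≤ C * (T ^ σ) ^ 2 * ‖Gamma (T * I)‖ ^ 2 := hbound σ T h0 h1 hT
        _ ≤ C * (T ^ σ) ^ 2 * _ :=
            mul_le_mul_of_nonneg_left (norm_Gamma_mul_I_sq_le hT) (by positivity)
        _ = _ := by
            rw [neg_div]
            ring
    refine ⟨√(C * (4 * Real.pi)), by positivity, fun σ T h0 h1 hT ↦ ?_⟩
    have hT0 : 0 < T := by linarith
    rcases le_total 0 σ with hσ | hσ
    · exact hunit σ T hσ (by simpa using h1) hT
    · have h := hunit (σ + 1) T (by linarith) (by linarith) hT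
      rw [show (((σ + 1 : ℝ) : ℂ) + T * I) = ((σ : ℂ) + T * I) + 1 by push_cast; ring,
        Gamma_add_one _ (hne hT), norm_mul, show σ + 1 - 1 / 2 = (σ - 1 / 2) + 1 by ring,
        Real.rpow_add_one hT0.ne'] at h
      have hTs : T ≤ ‖(σ : ℂ) + T * I‖ := by
        simpa [abs_of_pos hT0] using abs_im_le_norm ((σ : ℂ) + T * I)
      refine le_of_mul_le_mul_left ?_ hT0
      calc _ ≤ ‖(σ : ℂ) + T * I‖ * ‖Gamma ((σ : ℂ) + T * I)‖ := by gcongr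
        _ ≤ _ := h
        _ = _ := by ring
  | succ m ih =>
    obtain ⟨C, hC, hbound⟩ := ih
    refine ⟨C * (m + 2), by positivity, fun σ T h0 h1 hT ↦ ?_⟩
    have hT0 : 0 < T := by linarith
    rcases le_total σ (m + 1) with hσ | hσ
    · refine (hbound σ T h0 hσ hT).trans ?_
      gcongr
      exact le_mul_of_one_le_right hC.le (by linarith [m.cast_nonneg (α := ℝ)])
    · have hm : (0 : ℝ) ≤ m := m.cast_nonneg
      push_cast at h1
      have h := hbound (σ - 1) T (by linarith) (by linarith) hT
      have hs : ‖((σ - 1 : ℝ) : ℂ) + T * I‖ ≤ (m + 2) * T := by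
        refine (norm_add_le _ _).trans ?_
        rw [norm_mul, norm_I, norm_real, norm_real, Real.norm_of_nonneg hT0.le,
          Real.norm_of_nonneg (by linarith)]
        nlinarith
      rw [show ((σ : ℂ) + T * I) = (((σ - 1 : ℝ) : ℂ) + T * I) + 1 by push_cast; ring,
        Gamma_add_one _ (hne hT), norm_mul, show σ - 1 / 2 = (σ - 1 - 1 / 2) + 1 by ring,
        Real.rpow_add_one hT0.ne']
      calc _ ≤ (m + 2) * T * _ := mul_le_mul hs h (norm_nonneg _) (by positivity)
        _ = _ := by ring

theorem horizontal_integral_bound {q : ℕ} [NeZero q] (hq : 0 < q)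
    (χ : DirichletCharacter ℂ q) (hχ : χ.IsPrimitive)
    (k : ℝ) (hk : 1 ≤ k) (c : ℝ) (hc : -1 < c) (hc' : c < 0)
    (d : ℝ) (hd : (k + 1) / 2 < d) (hd' : d < k / 2 + 1)
    (x : ℝ) (hx : 0 < x) (A₁ : ℝ) (hA₁ : 0 < A₁) (hA₁' : A₁ < Real.pi / 4) :
    ∃ C > (0 : ℝ), ∀ T : ℝ, 2 ≤ T →
      (∀ σ : ℝ, c ≤ σ → σ ≤ d →
        1 / ‖(DirichletCharacter.LFunction χ
            ((k : ℂ) - 2 * σ - 2 * T * I))‖ ≤ Real.exp (2 * A₁ * T)) →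
      ‖(∫ σ in c..d,
          Complex.Gamma ((σ : ℂ) + T * I) *
            ((Real.pi * x ^ 2 / q : ℝ) : ℂ) ^ (-((σ : ℂ) + T * I)) /
            DirichletCharacter.LFunction χ ((k : ℂ) - 2 * ((σ : ℂ) + T * I)))‖ ≤
        C * T ^ (d - 1 / 2) * Real.exp ((2 * A₁ - Real.pi / 2) * T) := by
  have hcd : c < d := by linarith
  obtain ⟨m, hm⟩ := exists_nat_ge d
  obtain ⟨C, hC, hGamma⟩ := exists_norm_Gamma_le_of_mem_strip m
  have hq' : (0 : ℝ) < q := by exact_mod_cast hq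
  set b : ℝ := Real.pi * x ^ 2 / q with hb
  have hb0 : 0 < b := by positivity
  obtain ⟨B, hB⟩ := (isCompact_Icc (a := c) (b := d)).exists_bound_of_continuousOn
    (f := fun σ : ℝ ↦ b ^ (-σ)) (by fun_prop (disch := positivity))
  have hB0 : 0 < B := (norm_pos_iff.2 (by positivity)).trans_le (hB c ⟨le_rfl, hcd.le⟩)
  refine ⟨C * B * (d - c), mul_pos (mul_pos hC hB0) (by linarith), fun T hT hL ↦ ?_⟩
  have hT0 : 0 < T := by linarith
  have hpt : ∀ σ ∈ Set.uIoc c d, ‖Gamma ((σ : ℂ) + T * I) * (b : ℂ) ^ (-((σ : ℂ) + T * I)) /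
      DirichletCharacter.LFunction χ ((k : ℂ) - 2 * ((σ : ℂ) + T * I))‖ ≤
      C * (T ^ (d - 1 / 2) * Real.exp (-(Real.pi / 2) * T)) * B * Real.exp (2 * A₁ * T) := by
    intro σ hσ
    rw [Set.uIoc_of_le hcd.le] at hσ
    have hσL := hL σ hσ.1.le hσ.2
    rw [show (k : ℂ) - 2 * σ - 2 * T * I = (k : ℂ) - 2 * ((σ : ℂ) + T * I) by ring] at hσL
    have hσG : ‖Gamma ((σ : ℂ) + T * I)‖ ≤
        C * (T ^ (d - 1 / 2) * Real.exp (-(Real.pi / 2) * T)) := by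
      refine (hGamma σ T (by linarith [hσ.1]) (by linarith [hσ.2]) hT).trans ?_
      gcongr
      · linarith
      · exact hσ.2
    have hσB : ‖(b : ℂ) ^ (-((σ : ℂ) + T * I))‖ ≤ B := by
      rw [norm_cpow_eq_rpow_re_of_pos hb0]
      simpa using (le_abs_self _).trans (hB σ ⟨hσ.1.le, hσ.2⟩)
    rw [div_eq_mul_one_div, norm_mul, norm_mul, norm_div, norm_one]
    gcongr
  refine (intervalIntegral.norm_integral_le_of_norm_le_const hpt).trans_eq ?_
  rw [abs_of_pos (by linarith), show (2 * A₁ - Real.pi / 2) * T =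
    -(Real.pi / 2) * T + 2 * A₁ * T by ring, Real.exp_add]
  ring
end
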